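/- arXiv:2404.13825 — 6 statements merged into one kernel-verified Lean document; each statement's English description precedes it below -/
import Mathlib

section
/- (Divergence of the CUSUM statistic under the alternative; Theorem 3, part 2.) Fix admissible parameter pairs θ₁ = (ρ₁, p₁) and θ₂ = (ρ₂, p₂) with θ₁ ≠ θ₂, and λ ∈ (0,1). For each n, let μ_n be the law on S^{n+1} of the chain with X_0 ~ Binomial(N, p₁) that makes transitions according to the BAR(1) kernel with parameters θ₁ for steps t = 1,…,⌊nλ⌋ and according to the BAR(1) kernel with parameters θ₂ for steps t = ⌊nλ⌋+1,…,n. Then for every fixed integer k₀ ≥ 1 and every M > 0, μ_n({ C_n^{CLS} ≤ M }) → 0 as n → ∞; that is, C_n^{CLS} tends to +∞ in probability. -/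
open MeasureTheory Filter Finset Matrix

noncomputable section

/-- BAR(1) one-step transition probability `K(i,{j})` with parameters `(ρ, p)`,
where `β = p(1-ρ)` and `α = β + ρ`. -/
def barK (N : ℕ) (ρ p : ℝ) (i j : ℕ) : ℝ :=
  ∑ k ∈ Finset.Icc (i + j - N) (min i j),
    (Nat.choose i k : ℝ) * (Nat.choose (N - i) (j - k)) *
      (p * (1 - ρ) + ρ) ^ k * (1 - (p * (1 - ρ) + ρ)) ^ (i - k) *
      (p * (1 - ρ)) ^ (j - k) * (1 - p * (1 - ρ)) ^ (N + k - (i + j))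

/-- Binomial(N,p) probability mass function. -/
def binomPMF (N : ℕ) (p : ℝ) (i : ℕ) : ℝ :=
  (Nat.choose N i : ℝ) * p ^ i * (1 - p) ^ (N - i)

/-- CLS estimator of ρ from observations `x 0, …, x n`. -/
def clsRho (x : ℕ → ℝ) (n : ℕ) : ℝ :=
  ((n : ℝ) * ∑ t ∈ Finset.Icc 1 n, x t * x (t - 1)
      - (∑ t ∈ Finset.Icc 1 n, x t) * (∑ t ∈ Finset.Icc 1 n, x (t - 1))) /
    ((n : ℝ) * ∑ t ∈ Finset.Icc 1 n, (x (t - 1)) ^ 2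
      - (∑ t ∈ Finset.Icc 1 n, x (t - 1)) ^ 2)

/-- CLS estimator of p from observations `x 0, …, x n`. -/
def clsP (N : ℕ) (x : ℕ → ℝ) (n : ℕ) : ℝ :=
  ((∑ t ∈ Finset.Icc 1 n, x t) - clsRho x n * ∑ t ∈ Finset.Icc 1 n, x (t - 1)) /
    ((n : ℝ) * N * (1 - clsRho x n))

/-- The real-valued observation sequence attached to a trajectory `ω`. -/
def xR (ω : ℕ → ℕ) (t : ℕ) : ℝ := (ω t : ℝ)

/-- Conditional variance σ²(i) of the BAR(1) model. -/
def sigmaSq (N : ℕ) (ρ p : ℝ) (i : ℕ) : ℝ :=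
  ρ * (1 - ρ) * (1 - 2 * p) * i + N * p * (1 - ρ) * (1 - p * (1 - ρ))

/-- The matrix `W_CLS`. -/
def Wcls (N : ℕ) (ρ p : ℝ) : Matrix (Fin 2) (Fin 2) ℝ :=
  !![∑ i ∈ Finset.range (N + 1), binomPMF N p i * ((i : ℝ) - N * p) ^ 2 * sigmaSq N ρ p i,
     (N : ℝ) * (1 - ρ) *
       ∑ i ∈ Finset.range (N + 1), binomPMF N p i * ((i : ℝ) - N * p) * sigmaSq N ρ p i;
     (N : ℝ) * (1 - ρ) *
       ∑ i ∈ Finset.range (N + 1), binomPMF N p i * ((i : ℝ) - N * p) * sigmaSq N ρ p i,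
     (N : ℝ) ^ 2 * (1 - ρ) ^ 2 * ∑ i ∈ Finset.range (N + 1), binomPMF N p i * sigmaSq N ρ p i]

/-- Residual `s_t(ρ, p) = x_t - ρ x_{t-1} - N p (1-ρ)`. -/
def resid (N : ℕ) (ρ p : ℝ) (x : ℕ → ℝ) (t : ℕ) : ℝ :=
  x t - ρ * x (t - 1) - N * p * (1 - ρ)

/-- The empirical matrix `V̂_n`. -/
def Vhat (N n : ℕ) (x : ℕ → ℝ) : Matrix (Fin 2) (Fin 2) ℝ :=
  !![(1 / (n : ℝ)) * ∑ t ∈ Finset.Icc 1 n, (x (t - 1) - N * clsP N x n) ^ 2,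
     (1 / (n : ℝ)) * ∑ t ∈ Finset.Icc 1 n, (x (t - 1) - N * clsP N x n) * (N * (1 - clsRho x n));
     (1 / (n : ℝ)) * ∑ t ∈ Finset.Icc 1 n, (x (t - 1) - N * clsP N x n) * (N * (1 - clsRho x n)),
     (N : ℝ) ^ 2 * (1 - clsRho x n) ^ 2]

/-- The empirical matrix `Ŵ_n`. -/
def What (N n : ℕ) (x : ℕ → ℝ) : Matrix (Fin 2) (Fin 2) ℝ :=
  !![(1 / (n : ℝ)) * ∑ t ∈ Finset.Icc 1 n,
        (resid N (clsRho x n) (clsP N x n) x t * (x (t - 1) - N * clsP N x n)) ^ 2,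
     (1 / (n : ℝ)) * ∑ t ∈ Finset.Icc 1 n,
        (resid N (clsRho x n) (clsP N x n) x t) ^ 2 *
          (x (t - 1) - N * clsP N x n) * (N * (1 - clsRho x n));
     (1 / (n : ℝ)) * ∑ t ∈ Finset.Icc 1 n,
        (resid N (clsRho x n) (clsP N x n) x t) ^ 2 *
          (x (t - 1) - N * clsP N x n) * (N * (1 - clsRho x n)),
     (1 / (n : ℝ)) * ∑ t ∈ Finset.Icc 1 n,
        (resid N (clsRho x n) (clsP N x n) x t * (N * (1 - clsRho x n))) ^ 2]

/-- The CUSUM statistic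
`C_n^{CLS} = max_{k₀ ≤ k ≤ n} (k²/n) (θ̂_k - θ̂_n)ᵀ V̂_n Ŵ_n⁻¹ V̂_n (θ̂_k - θ̂_n)`.
(Mathlib's matrix inverse is `0` for singular matrices, as required.) -/
def cusumCLS (N k₀ n : ℕ) (x : ℕ → ℝ) : ℝ :=
  sSup ((fun k : ℕ =>
      ((k : ℝ) ^ 2 / n) *
        (![clsRho x k - clsRho x n, clsP N x k - clsP N x n] ⬝ᵥ
          ((Vhat N n x * (What N n x)⁻¹ * Vhat N n x).mulVec
            ![clsRho x k - clsRho x n, clsP N x k - clsP N x n]))) '' Set.Icc k₀ n)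

/-! ### Kernel facts -/

lemma binom_sum (n : ℕ) (a : ℝ) :
    ∑ k ∈ range (n + 1), binomPMF n a k = 1 := by
  have h := add_pow a (1 - a) n
  rw [add_sub_cancel, one_pow] at h
  rw [h]
  refine Finset.sum_congr rfl fun k _ => ?_
  unfold binomPMF; ring

lemma binom_mean (n : ℕ) (a : ℝ) :
    ∑ k ∈ range (n + 1), binomPMF n a k * (k : ℝ) = n * a := by
  have h := congrArg (Polynomial.eval a) (bernsteinPolynomial.sum_smul ℝ n)
  simp only [Polynomial.eval_finsetSum, bernsteinPolynomial, nsmul_eq_mul] at h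
  simp at h
  rw [← h]
  refine Finset.sum_congr rfl fun k _ => ?_
  unfold binomPMF; ring

lemma barK_sum_conv (N : ℕ) (ρ p : ℝ) (g : ℕ → ℝ) (i : ℕ) (hi : i ≤ N) :
    ∑ j ∈ range (N + 1), barK N ρ p i j * g j =
      ∑ k ∈ range (i + 1), ∑ l ∈ range (N - i + 1),
        binomPMF i (p * (1 - ρ) + ρ) k * binomPMF (N - i) (p * (1 - ρ)) l * g (k + l) := by
  unfold barK
  simp_rw [Finset.sum_mul]
  rw [Finset.sum_sigma', Finset.sum_sigma']
  refine Finset.sum_nbij' (fun q => ⟨q.2, q.1 - q.2⟩) (fun q => ⟨q.1 + q.2, q.1⟩) ?_ ?_ ?_ ?_ ?_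
  · rintro ⟨j, k⟩ h
    simp only [mem_sigma, mem_range, mem_Icc] at h ⊢
    omega
  · rintro ⟨j, k⟩ h
    simp only [mem_sigma, mem_range, mem_Icc] at h ⊢
    omega
  · rintro ⟨j, k⟩ h
    simp only [mem_sigma, mem_range, mem_Icc] at h ⊢
    have : k + (j - k) = j := by omega
    simp [this]
  · rintro ⟨j, k⟩ h
    simp
  · rintro ⟨j, k⟩ h
    simp only [mem_sigma, mem_range, mem_Icc] at h ⊢
    have h1 : k + (j - k) = j := by omega
    have h2 : N + k - (i + j) = N - i - (j - k) := by omega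
    rw [h1, h2]
    unfold binomPMF
    ring

lemma barK_sum (N : ℕ) (ρ p : ℝ) (i : ℕ) (hi : i ≤ N) :
    ∑ j ∈ range (N + 1), barK N ρ p i j = 1 := by
  have h := barK_sum_conv N ρ p (fun _ => 1) i hi
  simp only [mul_one] at h
  rw [h]
  simp_rw [← Finset.mul_sum, binom_sum]
  simp [binom_sum]

lemma barK_mean (N : ℕ) (ρ p : ℝ) (i : ℕ) (hi : i ≤ N) :
    ∑ j ∈ range (N + 1), barK N ρ p i j * (j : ℝ) = ρ * i + N * p * (1 - ρ) := by
  rw [barK_sum_conv N ρ p (fun j => (j : ℝ)) i hi]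
  have : ∀ k ∈ range (i + 1), ∑ l ∈ range (N - i + 1),
        binomPMF i (p * (1 - ρ) + ρ) k * binomPMF (N - i) (p * (1 - ρ)) l * ((k + l : ℕ) : ℝ)
      = binomPMF i (p * (1 - ρ) + ρ) k * k
        + binomPMF i (p * (1 - ρ) + ρ) k * (((N - i : ℕ) : ℝ) * (p * (1 - ρ))) := by
    intro k _
    rw [← binom_mean, Finset.mul_sum]
    have : binomPMF i (p * (1 - ρ) + ρ) k * k = ∑ l ∈ range (N - i + 1),
        binomPMF i (p * (1 - ρ) + ρ) k * k * binomPMF (N - i) (p * (1 - ρ)) l := by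
      rw [← Finset.mul_sum, binom_sum, mul_one]
    rw [this, ← Finset.sum_add_distrib]
    refine Finset.sum_congr rfl fun l _ => ?_
    push_cast; ring
  rw [Finset.sum_congr rfl this, Finset.sum_add_distrib, binom_mean, ← Finset.sum_mul, binom_sum]
  rw [Nat.cast_sub hi]; ring

/-- admissibility gives `0 < α, β < 1`. -/
lemma adm (ρ p : ℝ) (hp0 : 0 < p) (hp1 : p < 1)
    (hl : max (-(p / (1 - p))) (-((1 - p) / p)) < ρ) (hu : ρ < 1) :
    0 < p * (1 - ρ) ∧ p * (1 - ρ) < 1 ∧ 0 < p * (1 - ρ) + ρ ∧ p * (1 - ρ) + ρ < 1 := by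
  have h1 := lt_of_le_of_lt (le_max_left _ _) hl
  have h2 := lt_of_le_of_lt (le_max_right _ _) hl
  have q : 0 < 1 - p := by linarith
  have h1' : -p < ρ * (1 - p) := by
    rw [← neg_div, div_lt_iff₀ q] at h1; exact h1
  have h2' : -(1 - p) < ρ * p := by
    rw [← neg_div, div_lt_iff₀ hp0] at h2; exact h2
  refine ⟨by nlinarith, by nlinarith, by nlinarith, by nlinarith⟩

lemma barK_pos (N : ℕ) (ρ p : ℝ) (hp0 : 0 < p) (hp1 : p < 1)
    (hl : max (-(p / (1 - p))) (-((1 - p) / p)) < ρ) (hu : ρ < 1)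
    (i j : ℕ) (hi : i ≤ N) (hj : j ≤ N) : 0 < barK N ρ p i j := by
  obtain ⟨a, b, c, d⟩ := adm ρ p hp0 hp1 hl hu
  have b' : 0 < 1 - p * (1 - ρ) := by linarith
  have d' : 0 < 1 - (p * (1 - ρ) + ρ) := by linarith
  unfold barK
  apply Finset.sum_pos
  · intro k hk
    rw [mem_Icc] at hk
    have e1 : 0 < (Nat.choose i k : ℝ) := by
      exact_mod_cast Nat.choose_pos (by omega)
    have e2 : 0 < (Nat.choose (N - i) (j - k) : ℝ) := by
      exact_mod_cast Nat.choose_pos (by omega)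
    positivity
  · exact ⟨i + j - N, by rw [mem_Icc]; omega⟩

lemma barK_nonneg (N : ℕ) (ρ p : ℝ) (hp0 : 0 < p) (hp1 : p < 1)
    (hl : max (-(p / (1 - p))) (-((1 - p) / p)) < ρ) (hu : ρ < 1)
    (i j : ℕ) : 0 ≤ barK N ρ p i j := by
  by_cases h : i ≤ N ∧ j ≤ N
  · exact (barK_pos N ρ p hp0 hp1 hl hu i j h.1 h.2).le
  · unfold barK
    rw [Finset.Icc_eq_empty (by omega), Finset.sum_empty]

lemma barK_zero_right (N : ℕ) (ρ p : ℝ) (i j : ℕ) (hj : N < j) : barK N ρ p i j = 0 := by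
  unfold barK
  rw [Finset.Icc_eq_empty (by omega), Finset.sum_empty]

lemma binomPMF_zero (N : ℕ) (p : ℝ) (i : ℕ) (hi : N < i) : binomPMF N p i = 0 := by
  unfold binomPMF
  rw [Nat.choose_eq_zero_of_lt hi]; simp

lemma binomPMF_nonneg (N : ℕ) (p : ℝ) (hp0 : 0 < p) (hp1 : p < 1) (i : ℕ) :
    0 ≤ binomPMF N p i := by
  unfold binomPMF
  have : 0 < 1 - p := by linarith
  positivity

/-! ### Path expectations -/

/-- Expectation operator of the inhomogeneous chain. -/
def pathE (N : ℕ) (π : ℕ → ℝ) (P : ℕ → ℕ → ℕ → ℝ) : ℕ → ((ℕ → ℕ) → ℝ) → ℝ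
  | 0, F => ∑ i ∈ range (N + 1), π i * F (fun _ => i)
  | n + 1, F => pathE N π P n
      (fun x => ∑ j ∈ range (N + 1), P (n + 1) (x n) j * F (Function.update x (n + 1) j))

/-- Weight of a path. -/
def pathW (π : ℕ → ℝ) (P : ℕ → ℕ → ℕ → ℝ) (n : ℕ) (x : ℕ → ℕ) : ℝ :=
  π (x 0) * ∏ t ∈ Icc 1 n, P t (x (t - 1)) (x t)

lemma pathE_mono (N : ℕ) (π : ℕ → ℝ) (P : ℕ → ℕ → ℕ → ℝ) (hπ : ∀ i, 0 ≤ π i)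
    (hP : ∀ t i j, i ≤ N → j ≤ N → 0 ≤ P t i j) (n : ℕ) (F G : (ℕ → ℕ) → ℝ)
    (h : ∀ x : ℕ → ℕ, (∀ t, x t ≤ N) → F x ≤ G x) : pathE N π P n F ≤ pathE N π P n G := by
  induction n generalizing F G with
  | zero =>
    refine Finset.sum_le_sum fun i hi => mul_le_mul_of_nonneg_left (h _ fun _ => ?_) (hπ i)
    simpa [Nat.lt_succ_iff] using hi
  | succ n ih =>
    refine ih _ _ fun x hx => Finset.sum_le_sum fun j hj => ?_
    have hj' : j ≤ N := by simpa [Nat.lt_succ_iff] using hj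
    refine mul_le_mul_of_nonneg_left (h _ fun t => ?_) (hP _ _ _ (hx n) hj')
    by_cases ht : t = n + 1
    · subst ht; simpa using hj'
    · rw [Function.update_of_ne ht]; exact hx t

lemma pathE_add_const (N : ℕ) (π : ℕ → ℝ) (P : ℕ → ℕ → ℕ → ℝ) (hπ : ∀ i, 0 ≤ π i)
    (hP : ∀ t i j, i ≤ N → j ≤ N → 0 ≤ P t i j)
    (hπ1 : ∑ i ∈ range (N + 1), π i = 1)
    (hP1 : ∀ t i, i ≤ N → ∑ j ∈ range (N + 1), P t i j = 1)
    (n : ℕ) (F : (ℕ → ℕ) → ℝ) (c : ℝ) :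
    pathE N π P n (fun x => F x + c) = pathE N π P n F + c := by
  induction n generalizing F with
  | zero =>
    simp only [pathE, mul_add, Finset.sum_add_distrib, ← Finset.sum_mul, hπ1, one_mul]
  | succ n ih =>
    simp only [pathE]
    rw [← ih]
    apply le_antisymm
    all_goals
      refine pathE_mono N π P hπ hP n _ _ fun x hx => le_of_eq ?_
      simp only [mul_add, Finset.sum_add_distrib, ← Finset.sum_mul, hP1 _ _ (hx n), one_mul]

lemma pathE_smul (N : ℕ) (π : ℕ → ℝ) (P : ℕ → ℕ → ℕ → ℝ)
    (n : ℕ) (F : (ℕ → ℕ) → ℝ) (c : ℝ) :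
    pathE N π P n (fun x => F x * c) = pathE N π P n F * c := by
  induction n generalizing F with
  | zero =>
    simp only [pathE, Finset.sum_mul, mul_assoc]
  | succ n ih =>
    simp only [pathE]
    rw [← ih]
    simp only [Finset.sum_mul, mul_assoc]

lemma pathE_mart (N : ℕ) (π : ℕ → ℝ) (P : ℕ → ℕ → ℕ → ℝ) (hπ : ∀ i, 0 ≤ π i)
    (hP : ∀ t i j, i ≤ N → j ≤ N → 0 ≤ P t i j)
    (hπ1 : ∑ i ∈ range (N + 1), π i = 1)
    (hP1 : ∀ t i, i ≤ N → ∑ j ∈ range (N + 1), P t i j = 1)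
    (f : ℕ → ℕ → ℕ → ℝ) (B : ℝ)
    (hf0 : ∀ t i, i ≤ N → ∑ j ∈ range (N + 1), P t i j * f t i j = 0)
    (hfB : ∀ t i j, i ≤ N → j ≤ N → (f t i j) ^ 2 ≤ B) (n : ℕ) :
    pathE N π P n (fun x => (∑ t ∈ Icc 1 n, f t (x (t - 1)) (x t)) ^ 2) ≤ n * B := by
  induction n with
  | zero => simp [pathE]
  | succ n ih =>
    have key : pathE N π P (n + 1) (fun x => (∑ t ∈ Icc 1 (n + 1), f t (x (t - 1)) (x t)) ^ 2)
        ≤ pathE N π P n (fun x => (∑ t ∈ Icc 1 n, f t (x (t - 1)) (x t)) ^ 2 + B) := by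
      rw [pathE]
      refine pathE_mono N π P hπ hP n _ _ fun x hx => ?_
      set S := ∑ t ∈ Icc 1 n, f t (x (t - 1)) (x t) with hS
      have e : ∀ j, ∑ t ∈ Icc 1 (n + 1), f t (Function.update x (n + 1) j (t - 1))
          (Function.update x (n + 1) j t) = S + f (n + 1) (x n) j := by
        intro j
        rw [Finset.sum_Icc_succ_top (by omega)]
        congr 1
        · refine Finset.sum_congr rfl fun t ht => ?_
          rw [mem_Icc] at ht
          rw [Function.update_of_ne (by omega), Function.update_of_ne (by omega)]
        · rw [Function.update_self, Nat.add_sub_cancel, Function.update_of_ne (by omega)]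
      simp only [e]
      calc ∑ j ∈ range (N + 1), P (n + 1) (x n) j * (S + f (n + 1) (x n) j) ^ 2
          ≤ ∑ j ∈ range (N + 1), (P (n + 1) (x n) j * (S ^ 2 + B)
              + 2 * S * (P (n + 1) (x n) j * f (n + 1) (x n) j)) := by
            refine Finset.sum_le_sum fun j hj => ?_
            have hj' : j ≤ N := by simpa [Nat.lt_succ_iff] using hj
            have := mul_le_mul_of_nonneg_left (hfB (n + 1) (x n) j (hx n) hj')
              (hP (n + 1) (x n) j (hx n) hj')
            nlinarith
        _ = S ^ 2 + B := by
            rw [Finset.sum_add_distrib, ← Finset.sum_mul, ← Finset.mul_sum, hf0 _ _ (hx n),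
              hP1 _ _ (hx n)]; ring
    refine key.trans ?_
    rw [pathE_add_const N π P hπ hP hπ1 hP1]
    push_cast; linarith

lemma measure_le_pathE (N : ℕ) (π : ℕ → ℝ) (P : ℕ → ℕ → ℕ → ℝ) (hπ : ∀ i, 0 ≤ π i)
    (hP : ∀ t i j, 0 ≤ P t i j) (hπN : ∀ i, N < i → π i = 0)
    (hPN : ∀ t i j, N < j → P t i j = 0)
    (ν : Measure (ℕ → ℕ)) (A : Set (ℕ → ℕ)) (n : ℕ) (F : (ℕ → ℕ) → ℝ) (hF : ∀ x, 0 ≤ F x)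
    (h : ∀ x : ℕ → ℕ, ν {ω | ω ∈ A ∧ ∀ t ≤ n, ω t = x t} ≤ ENNReal.ofReal (pathW π P n x * F x)) :
    ν A ≤ ENNReal.ofReal (pathE N π P n F) := by
  induction n generalizing F with
  | zero =>
    have hA : A ⊆ ⋃ i : ℕ, {ω | ω ∈ A ∧ ∀ t ≤ 0, ω t = (fun _ => i) t} := by
      intro ω hω
      simp only [Set.mem_iUnion]
      exact ⟨ω 0, hω, fun t ht => by simp [Nat.le_zero.mp ht]⟩
    calc ν A ≤ ∑' i : ℕ, ν {ω | ω ∈ A ∧ ∀ t ≤ 0, ω t = (fun _ => i) t} :=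
          (measure_mono hA).trans (measure_iUnion_le _)
      _ ≤ ∑' i : ℕ, ENNReal.ofReal (π i * F (fun _ => i)) := by
          refine ENNReal.tsum_le_tsum fun i => ?_
          have := h (fun _ => i)
          simpa [pathW] using this
      _ = ∑ i ∈ range (N + 1), ENNReal.ofReal (π i * F (fun _ => i)) := by
          refine tsum_eq_sum fun i hi => ?_
          rw [hπN i (by simpa using hi)]; simp
      _ = ENNReal.ofReal (pathE N π P 0 F) := by
          rw [pathE, ENNReal.ofReal_sum_of_nonneg]
          exact fun i _ => mul_nonneg (hπ i) (hF _)
  | succ n ih =>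
    rw [pathE]
    refine ih _ (fun x => Finset.sum_nonneg fun j _ => mul_nonneg (hP _ _ _) (hF _)) fun x => ?_
    have hW : 0 ≤ pathW π P n x := mul_nonneg (hπ _) (Finset.prod_nonneg fun t _ => hP _ _ _)
    have hA : {ω | ω ∈ A ∧ ∀ t ≤ n, ω t = x t} ⊆
        ⋃ j : ℕ, {ω | ω ∈ A ∧ ∀ t ≤ n + 1, ω t = Function.update x (n + 1) j t} := by
      rintro ω ⟨hω, hx⟩
      simp only [Set.mem_iUnion]
      refine ⟨ω (n + 1), hω, fun t ht => ?_⟩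
      by_cases e : t = n + 1
      · subst e; simp
      · rw [Function.update_of_ne e]; exact hx t (by omega)
    have hw : ∀ j, pathW π P (n + 1) (Function.update x (n + 1) j)
        = pathW π P n x * P (n + 1) (x n) j := by
      intro j
      unfold pathW
      rw [Finset.prod_Icc_succ_top (by omega), Function.update_of_ne (by omega),
        Function.update_self, Nat.add_sub_cancel, Function.update_of_ne (by omega), mul_assoc]
      congr 2
      refine Finset.prod_congr rfl fun t ht => ?_
      rw [mem_Icc] at ht
      rw [Function.update_of_ne (by omega), Function.update_of_ne (by omega)]
    calc _ ≤ ∑' j : ℕ, ν {ω | ω ∈ A ∧ ∀ t ≤ n + 1, ω t = Function.update x (n + 1) j t} :=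
          (measure_mono hA).trans (measure_iUnion_le _)
      _ ≤ ∑' j : ℕ, ENNReal.ofReal (pathW π P n x *
            (P (n + 1) (x n) j * F (Function.update x (n + 1) j))) := by
          refine ENNReal.tsum_le_tsum fun j => ?_
          have := h (Function.update x (n + 1) j)
          rwa [hw, mul_assoc] at this
      _ = ∑ j ∈ range (N + 1), ENNReal.ofReal (pathW π P n x *
            (P (n + 1) (x n) j * F (Function.update x (n + 1) j))) := by
          refine tsum_eq_sum fun j hj => ?_
          rw [hPN (n + 1) (x n) j (by simpa using hj)]; simp
      _ = _ := by
          rw [Finset.mul_sum, ENNReal.ofReal_sum_of_nonneg]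
          exact fun i _ => mul_nonneg hW (mul_nonneg (hP _ _ _) (hF _))

lemma cheb (N : ℕ) (π : ℕ → ℝ) (P : ℕ → ℕ → ℕ → ℝ) (hπ : ∀ i, 0 ≤ π i)
    (hP : ∀ t i j, 0 ≤ P t i j) (hπN : ∀ i, N < i → π i = 0)
    (hPN : ∀ t i j, N < j → P t i j = 0)
    (hπ1 : ∑ i ∈ range (N + 1), π i = 1)
    (hP1 : ∀ t i, i ≤ N → ∑ j ∈ range (N + 1), P t i j = 1)
    (f : ℕ → ℕ → ℕ → ℝ) (B : ℝ)
    (hf0 : ∀ t i, i ≤ N → ∑ j ∈ range (N + 1), P t i j * f t i j = 0)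
    (hfB : ∀ t i j, i ≤ N → j ≤ N → (f t i j) ^ 2 ≤ B) (n : ℕ) (hn : 1 ≤ n)
    (ν : Measure (ℕ → ℕ))
    (hν : ∀ x : ℕ → ℕ, ν {ω | ∀ t ≤ n, ω t = x t} = ENNReal.ofReal (pathW π P n x))
    (ε : ℝ) (hε : 0 < ε) :
    ν {ω | ε * n < |∑ t ∈ Icc 1 n, f t (ω (t - 1)) (ω t)|} ≤
      ENNReal.ofReal (B / ε ^ 2 / n) := by
  have hn' : (0 : ℝ) < n := by exact_mod_cast hn
  have hq : 0 < ((ε * n) ^ 2)⁻¹ := by positivity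
  have key := measure_le_pathE N π P hπ hP hπN hPN ν
    {ω | ε * n < |∑ t ∈ Icc 1 n, f t (ω (t - 1)) (ω t)|} n
    (fun x => (∑ t ∈ Icc 1 n, f t (x (t - 1)) (x t)) ^ 2 * ((ε * n) ^ 2)⁻¹)
    (fun x => by positivity) ?_
  · refine key.trans (ENNReal.ofReal_le_ofReal ?_)
    rw [pathE_smul]
    have := pathE_mart N π P hπ (fun t i j _ _ => hP t i j) hπ1 hP1 f B hf0 hfB n
    calc _ ≤ (n * B) * ((ε * n) ^ 2)⁻¹ := mul_le_mul_of_nonneg_right this hq.le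
      _ = B / ε ^ 2 / n := by field_simp
  · intro x
    by_cases hx : ε * n < |∑ t ∈ Icc 1 n, f t (x (t - 1)) (x t)|
    · refine (measure_mono (fun ω h => h.2)).trans ((hν x).le.trans (ENNReal.ofReal_le_ofReal ?_))
      have hW : 0 ≤ pathW π P n x := mul_nonneg (hπ _) (Finset.prod_nonneg fun t _ => hP _ _ _)
      refine le_mul_of_one_le_right hW ?_
      rw [← div_eq_mul_inv, one_le_div (by positivity), ← sq_abs (∑ t ∈ Icc 1 n, _)]
      gcongr
    · have : {ω : ℕ → ℕ | ω ∈ {ω : ℕ → ℕ | ε * n < |∑ t ∈ Icc 1 n, f t (ω (t - 1)) (ω t)|} ∧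
          ∀ t ≤ n, ω t = x t} = ∅ := by
        ext ω
        simp only [Set.mem_ofPred_eq, Set.mem_empty_iff_false, iff_false, not_and]
        intro h1 h2
        apply hx
        convert h1 using 3
        rename_i t ht
        rw [mem_Icc] at ht
        rw [h2 t (by omega), h2 (t - 1) (by omega)]
      rw [this]; simp

lemma path_support (N : ℕ) (π : ℕ → ℝ) (P : ℕ → ℕ → ℕ → ℝ) (hπ : ∀ i, 0 ≤ π i)
    (hP : ∀ t i j, 0 ≤ P t i j) (hπN : ∀ i, N < i → π i = 0)
    (hPN : ∀ t i j, N < j → P t i j = 0) (n : ℕ)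
    (ν : Measure (ℕ → ℕ))
    (hν : ∀ x : ℕ → ℕ, ν {ω | ∀ t ≤ n, ω t = x t} = ENNReal.ofReal (pathW π P n x)) :
    ν {ω | ¬ ∀ t ≤ n, ω t ≤ N} = 0 := by
  have key := measure_le_pathE N π P hπ hP hπN hPN ν
    {ω | ¬ ∀ t ≤ n, ω t ≤ N} n (fun x => 0 * 0) (fun x => by simp) ?_
  · rw [pathE_smul] at key; simpa using key
  · intro x
    by_cases hx : ∀ t ≤ n, x t ≤ N
    · have : {ω : ℕ → ℕ | ω ∈ {ω : ℕ → ℕ | ¬ ∀ t ≤ n, ω t ≤ N} ∧ ∀ t ≤ n, ω t = x t} = ∅ := by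
        ext ω
        simp only [Set.mem_ofPred_eq, Set.mem_empty_iff_false, iff_false, not_and]
        intro h1 h2
        exact h1 fun t ht => by rw [h2 t ht]; exact hx t ht
      rw [this]; simp
    · refine (measure_mono (fun ω h => h.2)).trans ((hν x).le.trans ?_)
      push Not at hx
      obtain ⟨t, ht, htN⟩ := hx
      have : pathW π P n x = 0 := by
        unfold pathW
        rcases Nat.eq_zero_or_pos t with rfl | h0
        · rw [hπN _ htN, zero_mul]
        · have hm : t ∈ Icc 1 n := by rw [mem_Icc]; omega
          rw [Finset.prod_eq_zero hm (hPN t (x (t - 1)) (x t) htN), mul_zero]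
      rw [this]; simp

/-! ### Deterministic part -/

/-- Number of transitions `i → j` at times in `T`. -/
def cnt (ω : ℕ → ℕ) (i j : ℕ) (T : Finset ℕ) : ℝ :=
  ∑ t ∈ T, if ω (t - 1) = i ∧ ω t = j then (1 : ℝ) else 0

lemma vis_bound (ω : ℕ → ℕ) (T : Finset ℕ) (C : ℝ) (h0 : C ≤ cnt ω 0 0 T) (h1 : C ≤ cnt ω 1 0 T)
    (a b : ℝ) : C * (a ^ 2 + (a + b) ^ 2) ≤ ∑ t ∈ T, (a + b * xR ω (t - 1)) ^ 2 := by
  have e : cnt ω 0 0 T * a ^ 2 + cnt ω 1 0 T * (a + b) ^ 2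
      ≤ ∑ t ∈ T, (a + b * xR ω (t - 1)) ^ 2 := by
    unfold cnt
    rw [Finset.sum_mul, Finset.sum_mul, ← Finset.sum_add_distrib]
    refine Finset.sum_le_sum fun t _ => ?_
    unfold xR
    by_cases h : ω (t - 1) = 0
    · rw [h]
      split_ifs <;> simp_all <;> nlinarith [sq_nonneg a, sq_nonneg (a + b)]
    · by_cases h' : ω (t - 1) = 1
      · rw [h']
        split_ifs <;> simp_all <;> nlinarith [sq_nonneg a, sq_nonneg (a + b)]
      · simp [h, h']; positivity
  have := mul_le_mul_of_nonneg_right h0 (sq_nonneg a)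
  have := mul_le_mul_of_nonneg_right h1 (sq_nonneg (a + b))
  nlinarith

lemma cnt_exists (ω : ℕ → ℕ) (i j : ℕ) (T : Finset ℕ) (h : 0 < cnt ω i j T) :
    ∃ t ∈ T, ω (t - 1) = i ∧ ω t = j := by
  by_contra hc
  push Not at hc
  have : cnt ω i j T = 0 := Finset.sum_eq_zero fun t ht => by
    rw [if_neg]; rintro ⟨h1, h2⟩; exact hc t ht h1 h2
  linarith

/-- Intercept of the fitted regression. -/
def clsC (N : ℕ) (x : ℕ → ℝ) (n : ℕ) : ℝ := N * clsP N x n * (1 - clsRho x n)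

lemma sum_const_Icc (n : ℕ) (a : ℝ) : ∑ _t ∈ Icc 1 n, a = n * a := by simp

lemma tele (x : ℕ → ℝ) (n : ℕ) : ∑ t ∈ Icc 1 n, x t = ∑ t ∈ Icc 1 n, x (t - 1) + x n - x 0 := by
  induction n with
  | zero => simp
  | succ n ih =>
    rw [Finset.sum_Icc_succ_top (by omega), Finset.sum_Icc_succ_top (by omega), ih,
      Nat.add_sub_cancel]; ring

set_option maxHeartbeats 2000000 in
lemma est_facts (N : ℕ) (hN : 1 ≤ N) (c : ℝ) (hc : 0 < c) (ω : ℕ → ℕ) (n : ℕ)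
    (hn : 6 * (N : ℝ) ^ 2 / c ≤ n) (hω : ∀ t ≤ n, ω t ≤ N)
    (h00 : c * n ≤ cnt ω 0 0 (Icc 1 n)) (h10 : c * n ≤ cnt ω 1 0 (Icc 1 n)) :
    c / (4 * (N : ℝ) ^ 2) ≤ 1 - clsRho (xR ω) n ∧
    (∀ a b : ℝ, ∑ t ∈ Icc 1 n, (a + b * xR ω (t - 1)) *
      (xR ω t - clsC N (xR ω) n - clsRho (xR ω) n * xR ω (t - 1)) = 0) ∧
    (clsC N (xR ω) n) ^ 2 ≤ (N : ℝ) ^ 2 / c ∧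
    (clsC N (xR ω) n + clsRho (xR ω) n) ^ 2 ≤ (N : ℝ) ^ 2 / c := by
  have hN' : (1 : ℝ) ≤ N := by exact_mod_cast hN
  have hn0 : (0 : ℝ) < n := lt_of_lt_of_le (by positivity) hn
  have hx0 : ∀ t, 0 ≤ xR ω t := fun t => by unfold xR; positivity
  have hxN : ∀ t ≤ n, xR ω t ≤ N := fun t ht => by unfold xR; exact_mod_cast hω t ht
  set x := xR ω with hx
  set S1 := ∑ t ∈ Icc 1 n, x (t - 1) with hS1
  set S2 := ∑ t ∈ Icc 1 n, (x (t - 1)) ^ 2 with hS2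
  set T := ∑ t ∈ Icc 1 n, x t with hT
  set U := ∑ t ∈ Icc 1 n, x t * x (t - 1) with hU
  have hexp : ∀ a b : ℝ, ∑ t ∈ Icc 1 n, (a + b * x (t - 1)) ^ 2
      = n * a ^ 2 + 2 * a * b * S1 + b ^ 2 * S2 := by
    intro a b
    rw [hS1, hS2, ← sum_const_Icc, Finset.mul_sum, Finset.mul_sum, ← Finset.sum_add_distrib,
      ← Finset.sum_add_distrib]
    exact Finset.sum_congr rfl fun t _ => by ring
  have hvis := vis_bound ω (Icc 1 n) (c * n) h00 h10
  have hS1N : S1 ≤ n * N := by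
    rw [← sum_const_Icc]
    exact Finset.sum_le_sum fun t ht => hxN _ (by rw [mem_Icc] at ht; omega)
  have hS10 : 0 ≤ S1 := Finset.sum_nonneg fun t _ => hx0 _
  have hS2N : S2 ≤ n * (N : ℝ) ^ 2 := by
    rw [← sum_const_Icc]
    refine Finset.sum_le_sum fun t ht => ?_
    have := hxN (t - 1) (by rw [mem_Icc] at ht; omega)
    have := hx0 (t - 1)
    gcongr
  have hY2 : ∑ t ∈ Icc 1 n, (x t) ^ 2 ≤ n * (N : ℝ) ^ 2 := by
    rw [← sum_const_Icc]
    refine Finset.sum_le_sum fun t ht => ?_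
    have := hxN t (by rw [mem_Icc] at ht; omega)
    have := hx0 t
    gcongr
  set D := (n : ℝ) * S2 - S1 ^ 2 with hD
  have hDpos : 0 < D := by
    have h := hvis (-(S1 / n)) 1
    rw [← hx, hexp] at h
    have e : (n : ℝ) * (-(S1 / n)) ^ 2 + 2 * (-(S1 / n)) * 1 * S1 + 1 ^ 2 * S2 = D / n := by
      rw [hD]; field_simp; ring
    rw [e] at h
    have h2 : 0 < c * n * ((-(S1 / n)) ^ 2 + (-(S1 / n) + 1) ^ 2) := by
      have : 0 < (-(S1 / n)) ^ 2 + (-(S1 / n) + 1) ^ 2 := by nlinarith [sq_nonneg (S1 / n - 1 / 2)]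
      positivity
    have h3 := h2.trans_le h
    rw [lt_div_iff₀ hn0, zero_mul] at h3
    exact h3
  have hDle : D ≤ n ^ 2 * (N : ℝ) ^ 2 := by
    rw [hD]; nlinarith [sq_nonneg S1, mul_le_mul_of_nonneg_left hS2N hn0.le]
  have hρ : clsRho x n * D = n * U - T * S1 := by
    unfold clsRho
    rw [← hU, ← hT, ← hS1, ← hS2, ← hD, div_mul_cancel₀ _ hDpos.ne']
  set r := clsRho x n with hr
  have hx0N : x 0 ≤ N := hxN 0 (by omega)
  have hxnN : x n ≤ N := hxN n le_rfl
  have hxn0 := hx0 n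
  have hx00 := hx0 0
  have hTS : T = S1 + x n - x 0 := tele x n
  have hsq : (∑ t ∈ Icc 1 n, (x t) ^ 2) = S2 + x n ^ 2 - x 0 ^ 2 := tele (fun t => x t ^ 2) n
  have hjump : c * n ≤ ∑ t ∈ Icc 1 n, (x t - x (t - 1)) ^ 2 := by
    refine h10.trans ?_
    unfold cnt
    refine Finset.sum_le_sum fun t _ => ?_
    split_ifs with h
    · simp only [hx, xR, h.1, h.2]; norm_num
    · positivity
  have hjexp : ∑ t ∈ Icc 1 n, (x t - x (t - 1)) ^ 2 = (S2 + x n ^ 2 - x 0 ^ 2) - 2 * U + S2 := by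
    rw [← hsq, hU, hS2, Finset.mul_sum, ← Finset.sum_sub_distrib, ← Finset.sum_add_distrib]
    exact Finset.sum_congr rfl fun t _ => by ring
  have hnc : 6 * (N : ℝ) ^ 2 ≤ c * n := by
    rw [div_le_iff₀ hc] at hn; linarith
  have hlow : c * n ^ 2 / 4 ≤ (1 - r) * D := by
    have e : (1 - r) * D = n * (S2 - U) + S1 * (x n - x 0) := by
      have : (1 - r) * D = D - r * D := by ring
      rw [this, hρ, hTS, hD]; ring
    rw [e]
    have a1 : c * n / 2 - N ^ 2 / 2 ≤ S2 - U := by nlinarith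
    have a2 : -((N : ℝ) ^ 2 * n) ≤ S1 * (x n - x 0) := by nlinarith
    have a3 := mul_le_mul_of_nonneg_left a1 hn0.le
    have a4 := mul_le_mul_of_nonneg_right hnc hn0.le
    nlinarith
  have hr1 : 0 < 1 - r := by
    have : 0 < (1 - r) * D := lt_of_lt_of_le (by positivity) hlow
    exact (pos_iff_pos_of_mul_pos this).mpr hDpos
  have hτ : c / (4 * (N : ℝ) ^ 2) ≤ 1 - r := by
    rw [div_le_iff₀ (by positivity)]
    have := mul_le_mul_of_nonneg_left hDle hr1.le
    have h5 : c * (n : ℝ) ^ 2 ≤ ((1 - r) * (4 * (N : ℝ) ^ 2)) * n ^ 2 := by linarith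
    exact le_of_mul_le_mul_right h5 (by positivity)
  have hC : clsC N x n * n = T - r * S1 := by
    unfold clsC clsP
    rw [← hr, ← hT, ← hS1]
    have : (N : ℝ) ≠ 0 := by positivity
    field_simp
  set q := clsC N x n with hq
  have hN1 : T - n * q - r * S1 = 0 := by linarith
  have hN2 : U - q * S1 - r * S2 = 0 := by
    have : (U - q * S1 - r * S2) * n = 0 := by
      have : (U - q * S1 - r * S2) * n = n * U - (q * n) * S1 - r * (n * S2) := by ring
      rw [this, hC]
      rw [hD] at hρ
      linarith
    rcases mul_eq_zero.mp this with h | h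
    · exact h
    · exact absurd h hn0.ne'
  have hnormal : ∀ a b : ℝ, ∑ t ∈ Icc 1 n, (a + b * x (t - 1)) *
      (x t - q - r * x (t - 1)) = 0 := by
    intro a b
    have : ∑ t ∈ Icc 1 n, (a + b * x (t - 1)) * (x t - q - r * x (t - 1))
        = a * (T - n * q - r * S1) + b * (U - q * S1 - r * S2) := by
      rw [← sum_const_Icc, hT, hS1, hU, hS2]
      simp only [Finset.mul_sum, ← Finset.sum_sub_distrib, ← Finset.sum_add_distrib]
      exact Finset.sum_congr rfl fun t _ => by ring
    rw [this, hN1, hN2]; ring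
  have hfit : ∑ t ∈ Icc 1 n, (q + r * x (t - 1)) ^ 2 ≤ ∑ t ∈ Icc 1 n, (x t) ^ 2 := by
    have h := hnormal (2 * q) (2 * r)
    have : ∑ t ∈ Icc 1 n, (x t) ^ 2 = ∑ t ∈ Icc 1 n, (q + r * x (t - 1)) ^ 2
        + ∑ t ∈ Icc 1 n, (2 * q + 2 * r * x (t - 1)) * (x t - q - r * x (t - 1))
        + ∑ t ∈ Icc 1 n, (x t - q - r * x (t - 1)) ^ 2 := by
      simp only [← Finset.sum_add_distrib]
      exact Finset.sum_congr rfl fun t _ => by ring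
    rw [this, h]
    have : 0 ≤ ∑ t ∈ Icc 1 n, (x t - q - r * x (t - 1)) ^ 2 :=
      Finset.sum_nonneg fun t _ => sq_nonneg _
    linarith
  have hb : c * (q ^ 2 + (q + r) ^ 2) ≤ (N : ℝ) ^ 2 := by
    have h := ((hvis q r).trans hfit).trans hY2
    have h5 : (c * (q ^ 2 + (q + r) ^ 2)) * n ≤ (N : ℝ) ^ 2 * n := by linarith
    exact le_of_mul_le_mul_right h5 hn0
  refine ⟨hτ, hnormal, ?_, ?_⟩
  · rw [le_div_iff₀ hc]; nlinarith [sq_nonneg (q + r)]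
  · rw [le_div_iff₀ hc]; nlinarith [sq_nonneg q]

/-- Uniform bounds for the estimators. -/
lemma est_bounds (N : ℕ) (hN : 1 ≤ N) (c : ℝ) (hc : 0 < c) :
    ∃ B : ℝ, 1 ≤ B ∧ ∀ (ω : ℕ → ℕ) (n : ℕ),
    6 * (N : ℝ) ^ 2 / c ≤ n → (∀ t ≤ n, ω t ≤ N) →
    c * n ≤ cnt ω 0 0 (Icc 1 n) → c * n ≤ cnt ω 1 0 (Icc 1 n) →
    |clsC N (xR ω) n| ≤ B ∧ |clsRho (xR ω) n| ≤ B ∧ |clsP N (xR ω) n| ≤ B := by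
  have hN' : (1 : ℝ) ≤ N := by exact_mod_cast hN
  set s := Real.sqrt ((N : ℝ) ^ 2 / c) with hs
  have hs0 : 0 ≤ s := Real.sqrt_nonneg _
  set τ := c / (4 * (N : ℝ) ^ 2) with hτ
  have hτ0 : 0 < τ := by positivity
  refine ⟨1 + 2 * s + s / τ, ?_, ?_⟩
  · have : 0 ≤ s / τ := by positivity
    linarith
  intro ω n hn hω h00 h10
  obtain ⟨h1, -, h3, h4⟩ := est_facts N hN c hc ω n hn hω h00 h10
  have e1 : |clsC N (xR ω) n| ≤ s := Real.abs_le_sqrt h3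
  have e2 : |clsC N (xR ω) n + clsRho (xR ω) n| ≤ s := Real.abs_le_sqrt h4
  have hst : 0 ≤ s / τ := by positivity
  refine ⟨by linarith, ?_, ?_⟩
  · rw [abs_le] at *
    constructor <;> linarith
  · have hpos : 0 < 1 - clsRho (xR ω) n := lt_of_lt_of_le hτ0 h1
    have e : |clsC N (xR ω) n| = N * |clsP N (xR ω) n| * (1 - clsRho (xR ω) n) := by
      unfold clsC
      rw [abs_mul, abs_mul, abs_of_pos hpos, abs_of_nonneg (by positivity : (0 : ℝ) ≤ N)]
    have : |clsP N (xR ω) n| ≤ s / τ := by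
      rw [le_div_iff₀ hτ0]
      have ha := abs_nonneg (clsP N (xR ω) n)
      calc |clsP N (xR ω) n| * τ ≤ |clsP N (xR ω) n| * (1 - clsRho (xR ω) n) := by gcongr
        _ ≤ N * |clsP N (xR ω) n| * (1 - clsRho (xR ω) n) := by
            have : 0 ≤ |clsP N (xR ω) n| * (1 - clsRho (xR ω) n) := by positivity
            nlinarith
        _ = |clsC N (xR ω) n| := e.symm
        _ ≤ s := e1
    linarith

lemma quad2 (a b d e f g r q B : ℝ) (hdet : IsUnit (!![a, b; b, d] : Matrix (Fin 2) (Fin 2) ℝ).det)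
    (hpsd : ∀ y z : ℝ, 0 ≤ a * y ^ 2 + 2 * b * y * z + d * z ^ 2)
    (hB : 0 < B)
    (hWV : a * r ^ 2 + 2 * b * r * q + d * q ^ 2 ≤ B * (e * r ^ 2 + 2 * f * r * q + g * q ^ 2)) :
    e * r ^ 2 + 2 * f * r * q + g * q ^ 2 ≤
      B * (![r, q] ⬝ᵥ ((!![e, f; f, g] * (!![a, b; b, d] : Matrix (Fin 2) (Fin 2) ℝ)⁻¹ *
        !![e, f; f, g]).mulVec ![r, q])) := by
  set W : Matrix (Fin 2) (Fin 2) ℝ := !![a, b; b, d] with hW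
  obtain ⟨y, hy⟩ : ∃ y, y = W⁻¹.mulVec ((!![e, f; f, g] : Matrix (Fin 2) (Fin 2) ℝ).mulVec ![r, q]) :=
    ⟨_, rfl⟩
  have h1 : W.mulVec y = (!![e, f; f, g] : Matrix (Fin 2) (Fin 2) ℝ).mulVec ![r, q] := by
    rw [hy, Matrix.mulVec_mulVec, Matrix.mul_nonsing_inv _ hdet, Matrix.one_mulVec]
  rw [← Matrix.mulVec_mulVec, ← Matrix.mulVec_mulVec, ← hy]
  have k0 := congrFun h1 0
  have k1 := congrFun h1 1
  simp [hW, Matrix.mulVec, dotProduct, Fin.sum_univ_two] at k0 k1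
  simp only [Matrix.mulVec, dotProduct, Fin.sum_univ_two]
  simp
  have hp := hpsd (r - B * y 0) (q - B * y 1)
  have hz : a * y 0 ^ 2 + 2 * b * y 0 * y 1 + d * y 1 ^ 2
      = (e * r + f * q) * y 0 + (f * r + g * q) * y 1 := by
    rw [← k0, ← k1]; ring
  have hv : r * (a * y 0 + b * y 1) + q * (b * y 0 + d * y 1)
      = e * r ^ 2 + 2 * f * r * q + g * q ^ 2 := by
    rw [k0, k1]; ring
  set v := e * r ^ 2 + 2 * f * r * q + g * q ^ 2 with hvdef
  have hform : r * (e * y 0 + f * y 1) + q * (f * y 0 + g * y 1)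
      = a * y 0 ^ 2 + 2 * b * y 0 * y 1 + d * y 1 ^ 2 := by rw [hz]; ring
  rw [hform]
  set z := a * y 0 ^ 2 + 2 * b * y 0 * y 1 + d * y 1 ^ 2 with hzdef
  have hp2 : 0 ≤ (a * r ^ 2 + 2 * b * r * q + d * q ^ 2) - 2 * B * v + B ^ 2 * z := by
    have : (a * r ^ 2 + 2 * b * r * q + d * q ^ 2) - 2 * B * v + B ^ 2 * z
      = a * (r - B * y 0) ^ 2 + 2 * b * (r - B * y 0) * (q - B * y 1) + d * (q - B * y 1) ^ 2 := by
      rw [← hv, hzdef]; ring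
    rw [this]; exact hp
  have hp3 : B * v ≤ B * (B * z) := by linarith
  exact le_of_mul_le_mul_left hp3 hB

lemma form_lower (N : ℕ) (hN : 1 ≤ N) (c : ℝ) (hc : 0 < c) (ω : ℕ → ℕ) (n : ℕ) (hn : 1 ≤ n)
    (h00 : c * n ≤ cnt ω 0 0 (Icc 1 n)) (h10 : c * n ≤ cnt ω 1 0 (Icc 1 n))
    (h01 : c * n ≤ cnt ω 0 1 (Icc 1 n)) (h11 : c * n ≤ cnt ω 1 1 (Icc 1 n))
    (hρ : 0 < 1 - clsRho (xR ω) n) (B : ℝ) (hB : 0 < B)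
    (hs : ∀ t ∈ Icc 1 n, (resid N (clsRho (xR ω) n) (clsP N (xR ω) n) (xR ω) t) ^ 2 ≤ B)
    (r q e : ℝ) (he : e = N * (1 - clsRho (xR ω) n) * q - r * N * clsP N (xR ω) n) :
    c * (e ^ 2 + (e + r) ^ 2) ≤ B * (![r, q] ⬝ᵥ
      ((Vhat N n (xR ω) * (What N n (xR ω))⁻¹ * Vhat N n (xR ω)).mulVec ![r, q])) := by
  have hn0 : (0 : ℝ) < n := by exact_mod_cast hn
  have hN0 : (0 : ℝ) < N := by exact_mod_cast hN
  set x := xR ω with hx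
  set P := clsP N x n with hP
  set R := clsRho x n with hR
  set s := resid N R P x with hsdef
  have hVq : ∀ y z : ℝ,
      ((1 / (n : ℝ)) * ∑ t ∈ Icc 1 n, (x (t - 1) - N * P) ^ 2) * y ^ 2
      + 2 * ((1 / (n : ℝ)) * ∑ t ∈ Icc 1 n, (x (t - 1) - N * P) * (N * (1 - R))) * y * z
      + ((N : ℝ) ^ 2 * (1 - R) ^ 2) * z ^ 2
      = (1 / (n : ℝ)) * ∑ t ∈ Icc 1 n, ((x (t - 1) - N * P) * y + N * (1 - R) * z) ^ 2 := by
    intro y z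
    have : ((N : ℝ) ^ 2 * (1 - R) ^ 2) * z ^ 2
        = (1 / (n : ℝ)) * ∑ t ∈ Icc 1 n, ((N : ℝ) ^ 2 * (1 - R) ^ 2) * z ^ 2 := by
      rw [sum_const_Icc]; field_simp
    rw [this]
    simp only [Finset.mul_sum, Finset.sum_mul, ← Finset.sum_add_distrib]
    exact Finset.sum_congr rfl fun t _ => by ring
  have hWq : ∀ y z : ℝ,
      ((1 / (n : ℝ)) * ∑ t ∈ Icc 1 n, (s t * (x (t - 1) - N * P)) ^ 2) * y ^ 2
      + 2 * ((1 / (n : ℝ)) * ∑ t ∈ Icc 1 n, (s t) ^ 2 * (x (t - 1) - N * P) * (N * (1 - R))) * y * z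
      + ((1 / (n : ℝ)) * ∑ t ∈ Icc 1 n, (s t * (N * (1 - R))) ^ 2) * z ^ 2
      = (1 / (n : ℝ)) * ∑ t ∈ Icc 1 n,
        (s t) ^ 2 * ((x (t - 1) - N * P) * y + N * (1 - R) * z) ^ 2 := by
    intro y z
    simp only [Finset.mul_sum, Finset.sum_mul, ← Finset.sum_add_distrib]
    exact Finset.sum_congr rfl fun t _ => by ring
  have hcn : 0 < c * n := by positivity
  have hex : ∀ i : ℕ, (∃ t ∈ Icc 1 n, ω (t - 1) = i ∧ ω t = 0) →
      (∃ t ∈ Icc 1 n, ω (t - 1) = i ∧ ω t = 1) → ∃ t ∈ Icc 1 n, ω (t - 1) = i ∧ s t ≠ 0 := by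
    rintro i ⟨t, ht, h1, h2⟩ ⟨t', ht', h1', h2'⟩
    by_cases h : s t = 0
    · refine ⟨t', ht', h1', fun h' => ?_⟩
      simp only [hsdef, resid, hx, xR, h1, h2, h1', h2'] at h h'
      push_cast at h h'
      linarith
    · exact ⟨t, ht, h1, h⟩
  obtain ⟨t0, ht0, hω0, hs0⟩ := hex 0 (cnt_exists ω 0 0 _ (hcn.trans_le h00))
    (cnt_exists ω 0 1 _ (hcn.trans_le h01))
  obtain ⟨t1, ht1, hω1, hs1⟩ := hex 1 (cnt_exists ω 1 0 _ (hcn.trans_le h10))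
    (cnt_exists ω 1 1 _ (hcn.trans_le h11))
  have hWpsd : ∀ y z : ℝ, 0 ≤ (1 / (n : ℝ)) * ∑ t ∈ Icc 1 n,
        (s t) ^ 2 * ((x (t - 1) - N * P) * y + N * (1 - R) * z) ^ 2 := fun y z =>
    mul_nonneg (by positivity) (Finset.sum_nonneg fun t _ => by positivity)
  have hdet : IsUnit (What N n x).det := by
    rw [isUnit_iff_ne_zero]
    intro hd
    obtain ⟨v, hv0, hv⟩ := Matrix.exists_mulVec_eq_zero_iff.mpr hd
    have k0 := congrFun hv 0
    have k1 := congrFun hv 1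
    simp only [What, Matrix.mulVec, dotProduct, Fin.sum_univ_two] at k0 k1
    simp only [Matrix.of_apply, Matrix.cons_val', Matrix.cons_val_zero, Matrix.cons_val_one,
      Matrix.cons_val_fin_one, Pi.zero_apply] at k0 k1
    have hz := hWq (v 0) (v 1)
    have hz0 : (1 / (n : ℝ)) * ∑ t ∈ Icc 1 n,
        (s t) ^ 2 * ((x (t - 1) - N * P) * v 0 + N * (1 - R) * v 1) ^ 2 = 0 := by
      rw [← hz]
      linear_combination (v 0) * k0 + (v 1) * k1
    have hz1 := (mul_eq_zero.mp hz0).resolve_left (one_div_pos.mpr hn0).ne'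
    have hz2 : ∀ t ∈ Icc 1 n,
        (s t) ^ 2 * ((x (t - 1) - N * P) * v 0 + N * (1 - R) * v 1) ^ 2 = 0 := by
      refine (Finset.sum_eq_zero_iff_of_nonneg ?_).mp hz1
      intro t _
      positivity
    have a0 : (x (t0 - 1) - N * P) * v 0 + N * (1 - R) * v 1 = 0 := by
      have := hz2 t0 ht0
      simpa [hs0] using this
    have a1 : (x (t1 - 1) - N * P) * v 0 + N * (1 - R) * v 1 = 0 := by
      have := hz2 t1 ht1
      simpa [hs1] using this
    simp only [hx, xR, hω0, hω1] at a0 a1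
    push_cast at a0 a1
    have v0 : v 0 = 0 := by linarith
    have v1 : v 1 = 0 := by
      rw [v0] at a0
      have : N * (1 - R) * v 1 = 0 := by linarith
      exact (mul_eq_zero.mp this).resolve_left (mul_pos hN0 hρ).ne'
    apply hv0
    ext i
    fin_cases i
    · exact v0
    · exact v1
  have key := quad2 _ _ _ ((1 / (n : ℝ)) * ∑ t ∈ Icc 1 n, (x (t - 1) - N * P) ^ 2)
    ((1 / (n : ℝ)) * ∑ t ∈ Icc 1 n, (x (t - 1) - N * P) * (N * (1 - R)))
    ((N : ℝ) ^ 2 * (1 - R) ^ 2) r q B hdet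
    (fun y z => by rw [hWq]; exact hWpsd y z) hB
    (by
      rw [hWq, hVq]
      have hle : ∑ t ∈ Icc 1 n, (s t) ^ 2 * ((x (t - 1) - N * P) * r + N * (1 - R) * q) ^ 2
          ≤ B * ∑ t ∈ Icc 1 n, ((x (t - 1) - N * P) * r + N * (1 - R) * q) ^ 2 := by
        rw [Finset.mul_sum]
        exact Finset.sum_le_sum fun t ht => mul_le_mul_of_nonneg_right (hs t ht) (sq_nonneg _)
      have := mul_le_mul_of_nonneg_left hle (one_div_pos.mpr hn0).le
      linarith)
  refine le_trans ?_ key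
  rw [hVq]
  have hv := vis_bound ω (Icc 1 n) (c * n) h00 h10 e r
  have : ∑ t ∈ Icc 1 n, ((x (t - 1) - N * P) * r + N * (1 - R) * q) ^ 2
      = ∑ t ∈ Icc 1 n, (e + r * xR ω (t - 1)) ^ 2 :=
    Finset.sum_congr rfl fun t _ => by rw [he]; ring
  rw [this, one_div, inv_mul_eq_div, le_div_iff₀ hn0]
  linarith

/-- The good event. -/
def Good (N : ℕ) (c1 r1 c2 r2 c ε : ℝ) (m n : ℕ) (ω : ℕ → ℕ) : Prop :=
  (∀ t ≤ n, ω t ≤ N) ∧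
  (∀ i j, i ≤ 1 → j ≤ 1 → c * n ≤ cnt ω i j (Icc 1 m)) ∧
  (∀ i j, i ≤ 1 → j ≤ 1 → c * n ≤ cnt ω i j (Icc (m + 1) n)) ∧
  |∑ t ∈ Icc 1 m, (xR ω t - c1 - r1 * xR ω (t - 1))| ≤ ε * n ∧
  |∑ t ∈ Icc 1 m, xR ω (t - 1) * (xR ω t - c1 - r1 * xR ω (t - 1))| ≤ ε * n ∧
  |∑ t ∈ Icc (m + 1) n, (xR ω t - c2 - r2 * xR ω (t - 1))| ≤ ε * n ∧
  |∑ t ∈ Icc (m + 1) n, xR ω (t - 1) * (xR ω t - c2 - r2 * xR ω (t - 1))| ≤ ε * n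

lemma noise_bound (T : Finset ℕ) (x y : ℕ → ℝ) (E a b : ℝ)
    (h0 : |∑ t ∈ T, y t| ≤ E) (h1 : |∑ t ∈ T, x t * y t| ≤ E) :
    |∑ t ∈ T, (a + b * x t) * y t| ≤ (|a| + |b|) * E := by
  have : ∑ t ∈ T, (a + b * x t) * y t = a * ∑ t ∈ T, y t + b * ∑ t ∈ T, x t * y t := by
    rw [Finset.mul_sum, Finset.mul_sum, ← Finset.sum_add_distrib]
    exact Finset.sum_congr rfl fun t _ => by ring
  rw [this]
  calc _ ≤ |a * ∑ t ∈ T, y t| + |b * ∑ t ∈ T, x t * y t| := abs_add_le _ _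
    _ ≤ |a| * E + |b| * E := by rw [abs_mul, abs_mul]; gcongr
    _ = _ := by ring

lemma sum_Icc_split (f : ℕ → ℝ) (m n : ℕ) (h : m ≤ n) :
    ∑ t ∈ Icc 1 n, f t = ∑ t ∈ Icc 1 m, f t + ∑ t ∈ Icc (m + 1) n, f t := by
  rw [← Finset.sum_union]
  · congr 1
    ext t; simp only [mem_union, mem_Icc]; omega
  · rw [Finset.disjoint_left]
    intro t; simp only [mem_Icc]; omega

lemma sq_add_abs (e f : ℝ) : (|e| + |f|) ^ 2 ≤ 2 * (e ^ 2 + f ^ 2) := by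
  rw [← sq_abs e, ← sq_abs f]
  nlinarith [sq_nonneg (|e| - |f|)]

lemma cnt_split (ω : ℕ → ℕ) (i j m n : ℕ) (h : m ≤ n) :
    cnt ω i j (Icc 1 n) = cnt ω i j (Icc 1 m) + cnt ω i j (Icc (m + 1) n) :=
  sum_Icc_split _ m n h

lemma cnt_le (ω : ℕ → ℕ) (i j m : ℕ) : cnt ω i j (Icc 1 m) ≤ m := by
  have : cnt ω i j (Icc 1 m) ≤ ∑ _t ∈ Icc 1 m, (1 : ℝ) :=
    Finset.sum_le_sum fun t _ => by split_ifs <;> norm_num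
  rwa [sum_const_Icc, mul_one] at this

lemma prod_sum_bound (T : Finset ℕ) (n : ℕ) (hT : (T.card : ℝ) ≤ n) (x : ℕ → ℝ) (N a b u v : ℝ)
    (hN : 0 ≤ N)
    (hx : ∀ t ∈ T, |x t| ≤ N) :
    ∑ t ∈ T, (a + b * x t) * (u + v * x t) ≤ n * ((|a| + N * |b|) * (|u| + N * |v|)) := by
  have hb : ∀ (a b : ℝ), ∀ t ∈ T, |a + b * x t| ≤ |a| + N * |b| := by
    intro a b t ht
    refine (abs_add_le _ _).trans ?_
    rw [abs_mul, mul_comm N]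
    gcongr; exact hx t ht
  calc ∑ t ∈ T, (a + b * x t) * (u + v * x t)
      ≤ ∑ _t ∈ T, (|a| + N * |b|) * (|u| + N * |v|) := by
        refine Finset.sum_le_sum fun t ht => (le_abs_self _).trans ?_
        rw [abs_mul]
        have := hb a b t ht
        have := hb u v t ht
        gcongr
    _ = T.card * ((|a| + N * |b|) * (|u| + N * |v|)) := by simp
    _ ≤ _ := by
        gcongr

set_option maxHeartbeats 2000000 in
lemma core (N : ℕ) (hN : 1 ≤ N) (c1 r1 c2 r2 c ε : ℝ) (hc : 0 < c) (hε : 0 < ε) (m n : ℕ)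
    (hmn : m ≤ n) (hn : 1 ≤ n) (ω : ℕ → ℕ) (hG : Good N c1 r1 c2 r2 c ε m n ω)
    (ck rk cn rn : ℝ)
    (hk : ∀ a b : ℝ, ∑ t ∈ Icc 1 m, (a + b * xR ω (t - 1)) *
      (xR ω t - ck - rk * xR ω (t - 1)) = 0)
    (hnn : ∀ a b : ℝ, ∑ t ∈ Icc 1 n, (a + b * xR ω (t - 1)) *
      (xR ω t - cn - rn * xR ω (t - 1)) = 0) :
    c * ((c2 - c1) ^ 2 + ((c2 - c1) + (r2 - r1)) ^ 2) ≤
      (|c2 - c1| + N * |r2 - r1|) * (|cn - ck| + N * |rn - rk|)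
      + (|c2 - c1| + N * |r2 - r1|) * (5 * N * ε / c)
      + (|c2 - c1| + N * |r2 - r1|) * ε := by
  obtain ⟨hω, hI, hII, n1, n2, n3, n4⟩ := hG
  have hn0 : (0 : ℝ) < n := by exact_mod_cast hn
  have hN' : (1 : ℝ) ≤ N := by exact_mod_cast hN
  set X : ℕ → ℝ := fun t => xR ω (t - 1) with hX
  have hXN : ∀ t ∈ Icc 1 n, |X t| ≤ N := by
    intro t ht
    rw [mem_Icc] at ht
    rw [hX, abs_of_nonneg (by simp [xR])]
    simp only [xR]; exact_mod_cast hω (t - 1) (by omega)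
  -- first step
  have hz : |ck - c1| + |rk - r1| ≤ 5 * ε / c := by
    set a := ck - c1 with ha
    set b := rk - r1 with hb
    have e1 := noise_bound (Icc 1 m) X (fun t => xR ω t - c1 - r1 * xR ω (t - 1)) (ε * n) a b n1 n2
    have e2 := vis_bound ω (Icc 1 m) (c * n) (hI 0 0 (by omega) (by omega))
      (hI 1 0 (by omega) (by omega)) a b
    have e3 : ∑ t ∈ Icc 1 m, (a + b * xR ω (t - 1)) ^ 2
        = ∑ t ∈ Icc 1 m, (a + b * X t) * (xR ω t - c1 - r1 * xR ω (t - 1)) := by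
      have := hk a b
      rw [← sub_eq_zero, ← Finset.sum_sub_distrib] 
      rw [← neg_eq_zero, ← Finset.sum_neg_distrib, ← this]
      refine Finset.sum_congr rfl fun t _ => ?_
      simp only [hX, ha, hb]; ring
    have e4 := (e2.trans e3.le).trans ((le_abs_self _).trans e1)
    set z := |a| + |b| with hzdef
    have hz0 : 0 ≤ z := by positivity
    have e5 : z ^ 2 ≤ 5 * (a ^ 2 + (a + b) ^ 2) := by
      have h1 : |b| ≤ |a| + |a + b| := by
        have : b = (a + b) - a := by ring
        calc |b| = |(a + b) - a| := by rw [← this]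
          _ ≤ |a + b| + |a| := abs_sub _ _
          _ = _ := by ring
      have h2 : z ≤ 2 * |a| + |a + b| := by rw [hzdef]; linarith
      have h3 : z ^ 2 ≤ (2 * |a| + |a + b|) ^ 2 := by gcongr
      rw [← sq_abs a, ← sq_abs (a + b)]
      nlinarith [sq_nonneg (|a| - 2 * |a + b|)]
    have e6 : (c * (a ^ 2 + (a + b) ^ 2)) * n ≤ (z * ε) * n := by linarith
    have e7 := le_of_mul_le_mul_right e6 hn0
    rw [le_div_iff₀ hc]
    rcases hz0.eq_or_lt with h | h
    · rw [← h]; simp; positivity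
    · have e8 : (z * c) * z ≤ (5 * ε) * z := by nlinarith
      exact le_of_mul_le_mul_right e8 h
  set g0 := c2 - c1 with hg0
  set g1 := r2 - r1 with hg1
  have f1 := vis_bound ω (Icc (m + 1) n) (c * n) (hII 0 0 (by omega) (by omega))
      (hII 1 0 (by omega) (by omega)) g0 g1
  have f2 := noise_bound (Icc (m + 1) n) X (fun t => xR ω t - c2 - r2 * xR ω (t - 1)) (ε * n)
    g0 g1 n3 n4
  have hsplit := sum_Icc_split (fun t => (g0 + g1 * xR ω (t - 1)) *
      (xR ω t - cn - rn * xR ω (t - 1))) m n hmn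
  have hsplit2 := sum_Icc_split (fun t => (g0 + g1 * X t) *
      ((cn - ck) + (rn - rk) * X t)) m n hmn
  have f3 : ∑ t ∈ Icc (m + 1) n, (g0 + g1 * xR ω (t - 1)) ^ 2
      = ∑ t ∈ Icc 1 n, (g0 + g1 * X t) * ((cn - ck) + (rn - rk) * X t)
      + ∑ t ∈ Icc (m + 1) n, (g0 + g1 * X t) * ((ck - c1) + (rk - r1) * X t)
      - ∑ t ∈ Icc (m + 1) n, (g0 + g1 * X t) * (xR ω t - c2 - r2 * xR ω (t - 1)) := by
    rw [hnn g0 g1] at hsplit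
    have i1 : ∑ t ∈ Icc 1 m, (g0 + g1 * X t) * ((cn - ck) + (rn - rk) * X t)
        = - ∑ t ∈ Icc 1 m, (g0 + g1 * xR ω (t - 1)) * (xR ω t - cn - rn * xR ω (t - 1)) := by
      rw [← sub_eq_zero, sub_neg_eq_add, ← Finset.sum_add_distrib, ← hk g0 g1]
      exact Finset.sum_congr rfl fun t _ => by simp only [hX]; ring
    have i2 : ∑ t ∈ Icc (m + 1) n, (g0 + g1 * xR ω (t - 1)) ^ 2
      = ∑ t ∈ Icc (m + 1) n, (g0 + g1 * xR ω (t - 1)) * (xR ω t - cn - rn * xR ω (t - 1))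
      + ∑ t ∈ Icc (m + 1) n, (g0 + g1 * X t) * ((cn - ck) + (rn - rk) * X t)
      + ∑ t ∈ Icc (m + 1) n, (g0 + g1 * X t) * ((ck - c1) + (rk - r1) * X t)
      - ∑ t ∈ Icc (m + 1) n, (g0 + g1 * X t) * (xR ω t - c2 - r2 * xR ω (t - 1)) := by
      rw [← Finset.sum_add_distrib, ← Finset.sum_add_distrib, ← Finset.sum_sub_distrib]
      exact Finset.sum_congr rfl fun t _ => by simp only [hX, hg0, hg1]; ring
    rw [i2, hsplit2, i1]; linarith
  have f4 := prod_sum_bound (Icc 1 n) n (by simp) X N g0 g1 (cn - ck) (rn - rk) (by positivity) hXN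
  have f5 := prod_sum_bound (Icc (m + 1) n) n (by simp) X N g0 g1 (ck - c1) (rk - r1)
    (by positivity) (fun t ht => hXN t (by rw [mem_Icc] at ht ⊢; omega))
  have f6 := neg_le_of_abs_le f2
  set H := |g0| + N * |g1| with hH
  have hH0 : 0 ≤ H := by positivity
  have f7 : |ck - c1| + N * |rk - r1| ≤ 5 * N * ε / c := by
    calc |ck - c1| + N * |rk - r1| ≤ N * (|ck - c1| + |rk - r1|) := by
          nlinarith [abs_nonneg (ck - c1)]
      _ ≤ N * (5 * ε / c) := by gcongr
      _ = _ := by ring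
  have f8 : |g0| + |g1| ≤ H := by rw [hH]; nlinarith [abs_nonneg g1]
  have f9 : (c * (g0 ^ 2 + (g0 + g1) ^ 2)) * n ≤
      (H * (|cn - ck| + N * |rn - rk|) + H * (|ck - c1| + N * |rk - r1|) + (|g0| + |g1|) * ε) * n := by
    linarith
  refine (le_of_mul_le_mul_right f9 hn0).trans ?_
  gcongr

set_option maxHeartbeats 2000000 in
lemma deterministic (N : ℕ) (hN : 1 ≤ N) (c1 r1 c2 r2 c : ℝ) (hc : 0 < c)
    (hne : ¬ (c1 = c2 ∧ r1 = r2)) (k₀ : ℕ) (M : ℝ) :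
    ∃ ε : ℝ, 0 < ε ∧ ∃ n0 : ℕ, ∀ n ≥ n0, ∀ m ≤ n, ∀ ω : ℕ → ℕ,
      Good N c1 r1 c2 r2 c ε m n ω → M < cusumCLS N k₀ n (xR ω) := by
  have hN' : (1 : ℝ) ≤ N := by exact_mod_cast hN
  obtain ⟨B, hB1, hB⟩ := est_bounds N hN c hc
  set G := (c2 - c1) ^ 2 + ((c2 - c1) + (r2 - r1)) ^ 2 with hGdef
  have hGpos : 0 < G := by
    rcases (by positivity : 0 ≤ G).eq_or_lt with h | h
    · exfalso
      apply hne
      have a1 : (c2 - c1) ^ 2 = 0 := by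
        nlinarith [sq_nonneg (c2 - c1), sq_nonneg ((c2 - c1) + (r2 - r1))]
      have a2 : ((c2 - c1) + (r2 - r1)) ^ 2 = 0 := by
        nlinarith [sq_nonneg (c2 - c1), sq_nonneg ((c2 - c1) + (r2 - r1))]
      have b1 := pow_eq_zero_iff (two_ne_zero) |>.mp a1
      have b2 := pow_eq_zero_iff (two_ne_zero) |>.mp a2
      constructor <;> linarith
    · exact h
  set H := |c2 - c1| + N * |r2 - r1| with hH
  have hH0 : 0 ≤ H := by positivity
  set Q := H * (5 * N / c) + H + 1 with hQ
  have hQpos : 0 < Q := by positivity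
  set ε := c * G / 2 / Q with hε
  have hεpos : 0 < ε := by positivity
  have hεQ : H * (5 * N * ε / c) + H * ε ≤ c * G / 2 := by
    have : ε * Q = c * G / 2 := by rw [hε]; field_simp
    rw [← this, hQ]
    have : H * (5 * N * ε / c) = ε * (H * (5 * N / c)) := by ring
    rw [this]; nlinarith
  set γ := c * G / 2 with hγ
  have hγpos : 0 < γ := by positivity
  set L := (H + 1) * (1 + 2 * N * B + N) with hL
  have hLpos : 0 < L := by positivity
  set η := γ ^ 2 / (2 * L ^ 2) with hη
  have hηpos : 0 < η := by positivity
  set Bs := (N + B * N + B) ^ 2 with hBs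
  have hBspos : 0 < Bs := by positivity
  have w1 : 0 ≤ 6 * (N : ℝ) ^ 2 / c / c := by positivity
  have w2 : 0 ≤ 6 * (N : ℝ) ^ 2 / c := by positivity
  have w3 : 0 ≤ k₀ / c := by positivity
  have w4 : 0 ≤ |M| * Bs / (c ^ 3 * η) := by positivity
  obtain ⟨n0, hn0⟩ := exists_nat_gt (6 * (N : ℝ) ^ 2 / c / c + 6 * (N : ℝ) ^ 2 / c
    + k₀ / c + |M| * Bs / (c ^ 3 * η))
  refine ⟨ε, hεpos, n0, ?_⟩
  intro n hn m hmn ω hG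
  have hnn : (n0 : ℝ) ≤ n := by exact_mod_cast hn
  have q1 : 6 * (N : ℝ) ^ 2 / c / c < n := by linarith
  have q2 : 6 * (N : ℝ) ^ 2 / c < n := by linarith
  have q3 : k₀ / c < n := by linarith
  have q4 : |M| * Bs / (c ^ 3 * η) < n := by linarith
  clear hnn hn0
  have hnpos : (0 : ℝ) < n := lt_of_le_of_lt (by positivity) q2
  have hn1 : 1 ≤ n := by exact_mod_cast hnpos
  have hG' := hG
  obtain ⟨hω, hI, hII, -⟩ := hG'
  have hcm : c * n ≤ m := (hI 0 0 (by omega) (by omega)).trans (cnt_le _ _ _ _)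
  have hmn' : (m : ℝ) ≤ n := by exact_mod_cast hmn
  have hm6 : 6 * (N : ℝ) ^ 2 / c ≤ m := by
    rw [div_lt_iff₀ hc] at q1; linarith
  have hIm : ∀ i j, i ≤ 1 → j ≤ 1 → c * m ≤ cnt ω i j (Icc 1 m) := fun i j hi hj =>
    le_trans (by gcongr) (hI i j hi hj)
  have hIn : ∀ i j, i ≤ 1 → j ≤ 1 → c * n ≤ cnt ω i j (Icc 1 n) := fun i j hi hj => by
    rw [cnt_split ω i j m n hmn]
    have : 0 ≤ c * n := by positivity
    have := hI i j hi hj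
    have := hII i j hi hj
    linarith
  have hk₀m : k₀ ≤ m := by
    rw [div_lt_iff₀ hc] at q3
    have : (k₀ : ℝ) ≤ m := by linarith
    exact_mod_cast this
  have hωm : ∀ t ≤ m, ω t ≤ N := fun t ht => hω t (by omega)
  obtain ⟨-, um, -, -⟩ := est_facts N hN c hc ω m hm6 hωm (hIm 0 0 (by omega) (by omega))
    (hIm 1 0 (by omega) (by omega))
  obtain ⟨vn, un, -, -⟩ := est_facts N hN c hc ω n q2.le hω (hIn 0 0 (by omega) (by omega))
    (hIn 1 0 (by omega) (by omega))
  obtain ⟨-, -, bm⟩ := hB ω m hm6 hωm (hIm 0 0 (by omega) (by omega))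
    (hIm 1 0 (by omega) (by omega))
  obtain ⟨bn1, bn2, bn3⟩ := hB ω n q2.le hω (hIn 0 0 (by omega) (by omega))
    (hIn 1 0 (by omega) (by omega))
  have hcore := core N hN c1 r1 c2 r2 c ε hc hεpos m n hmn hn1 ω hG _ _ _ _ um un
  set r := clsRho (xR ω) m - clsRho (xR ω) n with hr
  set q := clsP N (xR ω) m - clsP N (xR ω) n with hq
  obtain ⟨e, he⟩ : ∃ e, e = N * (1 - clsRho (xR ω) n) * q - r * N * clsP N (xR ω) n := ⟨_, rfl⟩
  have hρpos : 0 < 1 - clsRho (xR ω) n := lt_of_lt_of_le (by positivity) vn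
  have hres : ∀ t ∈ Icc 1 n,
      (resid N (clsRho (xR ω) n) (clsP N (xR ω) n) (xR ω) t) ^ 2 ≤ Bs := by
    intro t ht
    rw [mem_Icc] at ht
    have a1 : |xR ω t| ≤ N := by
      rw [abs_of_nonneg (by simp [xR])]; simp only [xR]; exact_mod_cast hω t (by omega)
    have a2 : |xR ω (t - 1)| ≤ N := by
      rw [abs_of_nonneg (by simp [xR])]; simp only [xR]; exact_mod_cast hω (t - 1) (by omega)
    rw [hBs, ← sq_abs]
    have : |resid N (clsRho (xR ω) n) (clsP N (xR ω) n) (xR ω) t| ≤ N + B * N + B := by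
      calc |resid N (clsRho (xR ω) n) (clsP N (xR ω) n) (xR ω) t|
          = |xR ω t - clsRho (xR ω) n * xR ω (t - 1) - clsC N (xR ω) n| := by
            simp only [resid, clsC]
        _ ≤ |xR ω t| + |clsRho (xR ω) n * xR ω (t - 1)| + |clsC N (xR ω) n| :=
            (abs_sub _ _).trans (add_le_add_left (abs_sub _ _) _)
        _ ≤ N + B * N + B := by
            rw [abs_mul]; gcongr
    gcongr
  have hform := form_lower N hN c hc ω n hn1 (hIn 0 0 (by omega) (by omega))
    (hIn 1 0 (by omega) (by omega)) (hIn 0 1 (by omega) (by omega)) (hIn 1 1 (by omega) (by omega))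
    hρpos Bs hBspos hres r q e he
  have hlow : η ≤ e ^ 2 + (e + r) ^ 2 := by
    have d2 : |clsRho (xR ω) n - clsRho (xR ω) m| = |r| := by rw [hr, abs_sub_comm]
    have d1 : |clsC N (xR ω) n - clsC N (xR ω) m| ≤ |e| + 2 * N * B * |r| := by
      have : clsC N (xR ω) n - clsC N (xR ω) m = N * q * r - e := by
        rw [he, hr, hq]; unfold clsC; ring
      rw [this]
      have hqB : |q| ≤ 2 * B := by
        refine (abs_sub _ _).trans ?_; linarith
      calc |N * q * r - e| ≤ |N * q * r| + |e| := abs_sub _ _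
        _ = N * |q| * |r| + |e| := by rw [abs_mul, abs_mul, abs_of_nonneg (by positivity : (0:ℝ) ≤ N)]
        _ ≤ N * (2 * B) * |r| + |e| := by gcongr
        _ = _ := by ring
    have hre : |r| ≤ |e| + |e + r| := by
      have : r = (e + r) - e := by ring
      calc |r| = |(e + r) - e| := by rw [← this]
        _ ≤ |e + r| + |e| := abs_sub _ _
        _ = _ := by ring
    have hNB : 0 ≤ 2 * N * B + N := by positivity
    have d3 : |clsC N (xR ω) n - clsC N (xR ω) m| + N * |clsRho (xR ω) n - clsRho (xR ω) m|
        ≤ (1 + 2 * N * B + N) * (|e| + |e + r|) := by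
      rw [d2]
      have := mul_le_mul_of_nonneg_left hre hNB
      have := abs_nonneg (e + r)
      linarith
    have d4 : γ ≤ L * (|e| + |e + r|) := by
      have s1 : γ ≤ H * (|clsC N (xR ω) n - clsC N (xR ω) m|
          + N * |clsRho (xR ω) n - clsRho (xR ω) m|) := by
        linarith
      refine s1.trans ?_
      rw [hL, mul_assoc]
      refine mul_le_mul (by linarith) d3 (by positivity) (by positivity)
    have d5 : γ ^ 2 ≤ (L * (|e| + |e + r|)) ^ 2 := by gcongr
    rw [hη, div_le_iff₀ (by positivity)]
    have d6 : (|e| + |e + r|) ^ 2 ≤ 2 * (e ^ 2 + (e + r) ^ 2) := sq_add_abs _ _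
    calc γ ^ 2 ≤ (L * (|e| + |e + r|)) ^ 2 := d5
      _ = L ^ 2 * (|e| + |e + r|) ^ 2 := by ring
      _ ≤ L ^ 2 * (2 * (e ^ 2 + (e + r) ^ 2)) := by gcongr
      _ = _ := by ring
  set form := (![r, q] ⬝ᵥ
      ((Vhat N n (xR ω) * (What N n (xR ω))⁻¹ * Vhat N n (xR ω)).mulVec ![r, q])) with hformdef
  have hform2 : c * η ≤ Bs * form := le_trans (by gcongr) hform
  have hform3 : c * η / Bs ≤ form := by rw [div_le_iff₀ hBspos]; linarith
  have hval : M < ((m : ℝ) ^ 2 / n) * form := by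
    have t1 : c ^ 2 * n ≤ (m : ℝ) ^ 2 / n := by
      rw [le_div_iff₀ hnpos]
      calc c ^ 2 * n * n = (c * n) ^ 2 := by ring
        _ ≤ (m : ℝ) ^ 2 := by gcongr
    have t2 : |M| < c ^ 2 * n * (c * η / Bs) := by
      rw [div_lt_iff₀ (by positivity)] at q4
      have : c ^ 2 * n * (c * η / Bs) = n * (c ^ 3 * η) / Bs := by ring
      rw [this, lt_div_iff₀ hBspos]; exact q4
    calc M ≤ |M| := le_abs_self _
      _ < c ^ 2 * n * (c * η / Bs) := t2
      _ ≤ _ := mul_le_mul t1 hform3 (by positivity) (by positivity)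
  refine hval.trans_le ?_
  unfold cusumCLS
  refine le_csSup ((Set.finite_Icc k₀ n).image _).bddAbove ?_
  exact ⟨m, ⟨hk₀m, hmn⟩, rfl⟩

/-! ### Probabilistic assembly -/

/-- Kernel on `{0,…,N}` extended by zero. -/
structure IsKer (N : ℕ) (K : ℕ → ℕ → ℝ) : Prop where
  nonneg : ∀ i j, 0 ≤ K i j
  zero : ∀ i j, N < j → K i j = 0
  sum : ∀ i, i ≤ N → ∑ j ∈ range (N + 1), K i j = 1

lemma barK_isKer (N : ℕ) (ρ p : ℝ) (hp0 : 0 < p) (hp1 : p < 1)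
    (hl : max (-(p / (1 - p))) (-((1 - p) / p)) < ρ) (hu : ρ < 1) : IsKer N (barK N ρ p) :=
  ⟨barK_nonneg N ρ p hp0 hp1 hl hu, barK_zero_right N ρ p, barK_sum N ρ p⟩

/-- The compensated block sum. -/
def blockSum (N : ℕ) (K : ℕ → ℕ → ℝ) (g : ℕ → ℕ → ℝ) (a b : ℕ) (ω : ℕ → ℕ) : ℝ :=
  ∑ t ∈ Icc (a + 1) b, (g (ω (t - 1)) (ω t)
    - ∑ l ∈ range (N + 1), K (ω (t - 1)) l * g (ω (t - 1)) l)

lemma lln_block (N : ℕ) (π : ℕ → ℝ) (hπ : ∀ i, 0 ≤ π i) (hπN : ∀ i, N < i → π i = 0)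
    (hπ1 : ∑ i ∈ range (N + 1), π i = 1)
    (P : ℕ → ℕ → ℕ → ℕ → ℝ) (hP : ∀ n t, IsKer N (P n t))
    (μ : ℕ → Measure (ℕ → ℕ))
    (hμ : ∀ n (x : ℕ → ℕ), μ n {ω | ∀ t ≤ n, ω t = x t} = ENNReal.ofReal (pathW π (P n) n x))
    (K : ℕ → ℕ → ℝ) (hK : IsKer N K) (a b : ℕ → ℕ)
    (hab : ∀ n, ∀ t ∈ Icc (a n + 1) (b n), t ≤ n ∧ P n t = K)
    (g : ℕ → ℕ → ℝ) (ε : ℝ) (hε : 0 < ε) :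
    Tendsto (fun n : ℕ => μ n {ω | ε * n < |blockSum N K g (a n) (b n) ω|}) atTop (nhds 0) := by
  set h : ℕ → ℕ → ℝ := fun i j => g i j - ∑ l ∈ range (N + 1), K i l * g i l with hh
  set B := ∑ i ∈ range (N + 1), ∑ j ∈ range (N + 1), (h i j) ^ 2 with hB
  have hB0 : 0 ≤ B := Finset.sum_nonneg fun i _ => Finset.sum_nonneg fun j _ => sq_nonneg _
  have hbound : ∀ n : ℕ, 1 ≤ n → μ n {ω | ε * n < |blockSum N K g (a n) (b n) ω|} ≤
      ENNReal.ofReal (B / ε ^ 2 / n) := by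
    intro n hn
    have key := cheb N π (P n) hπ (fun t => (hP n t).nonneg) hπN (fun t => (hP n t).zero) hπ1
      (fun t => (hP n t).sum)
      (fun t i j => if t ∈ Icc (a n + 1) (b n) then h i j else 0) B ?_ ?_ n hn (μ n) (hμ n) ε hε
    · convert key using 6
      rename_i ω
      unfold blockSum
      rw [← Finset.sum_filter]
      refine Finset.sum_congr ?_ fun t _ => rfl
      ext t
      simp only [mem_filter]
      constructor
      · intro ht
        have := (hab n t ht).1
        refine ⟨?_, ht⟩
        rw [mem_Icc] at ht ⊢; omega
      · exact fun ht => ht.2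
    · intro t i hi
      by_cases ht : t ∈ Icc (a n + 1) (b n)
      · simp only [ht, if_true, (hab n t ht).2, hh]
        simp only [mul_sub, Finset.sum_sub_distrib, ← Finset.sum_mul, hK.sum i hi]
        ring
      · simp only [ht, if_false, mul_zero, Finset.sum_const_zero]
    · intro t i j hi hj
      by_cases ht : t ∈ Icc (a n + 1) (b n)
      · simp only [ht, if_true, hB]
        calc (h i j) ^ 2 ≤ ∑ j ∈ range (N + 1), (h i j) ^ 2 :=
              Finset.single_le_sum (f := fun j => (h i j) ^ 2) (fun _ _ => sq_nonneg _)
                (by simp; omega)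
          _ ≤ _ := Finset.single_le_sum (f := fun i => ∑ j ∈ range (N + 1), (h i j) ^ 2)
                (fun _ _ => Finset.sum_nonneg fun j _ => sq_nonneg _) (by simp; omega)
      · simp only [ht, if_false]; simpa using hB0
  have hlim : Tendsto (fun n : ℕ => ENNReal.ofReal (B / ε ^ 2 / n)) atTop (nhds 0) := by
    rw [← ENNReal.ofReal_zero]
    exact (ENNReal.continuous_ofReal.tendsto 0).comp
      (tendsto_const_div_atTop_nhds_zero_nat (B / ε ^ 2))
  refine tendsto_of_tendsto_of_tendsto_of_le_of_le' tendsto_const_nhds hlim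
    (Eventually.of_forall fun n => zero_le) ?_
  filter_upwards [eventually_ge_atTop 1] with n hn using hbound n hn

lemma tz_union (μ : ℕ → Measure (ℕ → ℕ)) (A B : ℕ → Set (ℕ → ℕ))
    (hA : Tendsto (fun n => μ n (A n)) atTop (nhds 0))
    (hB : Tendsto (fun n => μ n (B n)) atTop (nhds 0)) :
    Tendsto (fun n => μ n (A n ∪ B n)) atTop (nhds 0) := by
  have := hA.add hB
  rw [add_zero] at this
  exact tendsto_of_tendsto_of_tendsto_of_le_of_le tendsto_const_nhds this
    (fun n => zero_le) (fun n => measure_union_le _ _)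

lemma tz_mono (μ : ℕ → Measure (ℕ → ℕ)) (A B : ℕ → Set (ℕ → ℕ))
    (hB : Tendsto (fun n => μ n (B n)) atTop (nhds 0))
    (h : ∀ᶠ n in atTop, A n ⊆ B n) :
    Tendsto (fun n => μ n (A n)) atTop (nhds 0) := by
  refine tendsto_of_tendsto_of_tendsto_of_le_of_le' tendsto_const_nhds hB
    (Eventually.of_forall fun n => zero_le) ?_
  filter_upwards [h] with n hn using measure_mono hn

lemma tz_iUnion {ι : Type} [Fintype ι] (μ : ℕ → Measure (ℕ → ℕ)) (A : ι → ℕ → Set (ℕ → ℕ))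
    (hA : ∀ i, Tendsto (fun n => μ n (A i n)) atTop (nhds 0)) :
    Tendsto (fun n => μ n (⋃ i, A i n)) atTop (nhds 0) := by
  have := tendsto_finsetSum (Finset.univ : Finset ι) (fun i _ => hA i)
  rw [Finset.sum_const_zero] at this
  refine tendsto_of_tendsto_of_tendsto_of_le_of_le tendsto_const_nhds this
    (fun n => zero_le) (fun n => ?_)
  exact measure_iUnion_fintype_le _ _

lemma tele_block (y : ℕ → ℝ) (a b : ℕ) (hab : a ≤ b) :
    ∑ t ∈ Icc (a + 1) b, y t = ∑ t ∈ Icc (a + 1) b, y (t - 1) + y b - y a := by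
  induction b, hab using Nat.le_induction with
  | base => simp
  | succ n hn ih =>
    rw [Finset.sum_Icc_succ_top (by omega), Finset.sum_Icc_succ_top (by omega), ih,
      Nat.add_sub_cancel]; ring

/-- Indicator of a target state. -/
def gV (j : ℕ) : ℕ → ℕ → ℝ := fun _ j' => if j' = j then 1 else 0

/-- Indicator of a transition. -/
def gT (i j : ℕ) : ℕ → ℕ → ℝ := fun i' j' => if i' = i ∧ j' = j then 1 else 0

lemma block_cnt (N : ℕ) (hN : 1 ≤ N) (K : ℕ → ℕ → ℝ) (κ c1 : ℝ) (hκ : 0 < κ) (hc1 : 0 < c1)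
    (hKκ : ∀ i j, i ≤ N → j ≤ 1 → κ ≤ K i j) (a b n : ℕ) (hab : a ≤ b) (hbn : b ≤ n)
    (hlen : c1 * n ≤ (b : ℝ) - a) (hn : 4 / (κ * c1) ≤ n) (ω : ℕ → ℕ) (hω : ∀ t ≤ n, ω t ≤ N)
    (hV : ∀ j, j ≤ 1 → |blockSum N K (gV j) a b ω| ≤ κ * c1 / 4 * n)
    (hT : ∀ i j, i ≤ 1 → j ≤ 1 → |blockSum N K (gT i j) a b ω| ≤ κ ^ 2 * c1 / 4 * n)
    (i j : ℕ) (hi : i ≤ 1) (hj : j ≤ 1) : κ ^ 2 * c1 / 4 * n ≤ cnt ω i j (Icc (a + 1) b) := by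
  have hn1 : 1 ≤ κ * c1 / 4 * n := by
    rw [div_le_iff₀ (by positivity)] at hn; linarith
  set y : ℕ → ℝ := fun t => if ω t = i then 1 else 0 with hy
  have hy0 : ∀ t, 0 ≤ y t := fun t => by simp only [hy]; split_ifs <;> norm_num
  have hy1 : ∀ t, y t ≤ 1 := fun t => by simp only [hy]; split_ifs <;> norm_num
  have h1 : κ * ((b : ℝ) - a) - κ * c1 / 4 * n ≤ ∑ t ∈ Icc (a + 1) b, y t := by
    have h := (abs_le.mp (hV i hi)).1
    have : blockSum N K (gV i) a b ω ≤ ∑ t ∈ Icc (a + 1) b, (y t - κ) := by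
      refine Finset.sum_le_sum fun t ht => ?_
      rw [mem_Icc] at ht
      have hs : ∑ l ∈ range (N + 1), K (ω (t - 1)) l * gV i (ω (t - 1)) l = K (ω (t - 1)) i := by
        unfold gV
        simp only [mul_ite, mul_one, mul_zero]
        rw [Finset.sum_ite_eq', if_pos (by simp; omega)]
      rw [hs]
      have := hKκ (ω (t - 1)) i (hω _ (by omega)) hi
      simp only [gV, hy]; linarith
    rw [Finset.sum_sub_distrib, Finset.sum_const, Nat.card_Icc, nsmul_eq_mul] at this
    have e : ((b + 1 - (a + 1) : ℕ) : ℝ) = (b : ℝ) - a := by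
      rw [Nat.add_sub_add_right, Nat.cast_sub hab]
    rw [e] at this
    linarith
  have h2 := tele_block y a b hab
  have h3 : κ * c1 / 2 * n ≤ ∑ t ∈ Icc (a + 1) b, y (t - 1) := by
    have := mul_le_mul_of_nonneg_left hlen hκ.le
    have := hy1 b
    have := hy0 a
    linarith
  have h4 : κ * ∑ t ∈ Icc (a + 1) b, y (t - 1) - κ ^ 2 * c1 / 4 * n
      ≤ cnt ω i j (Icc (a + 1) b) := by
    have h := (abs_le.mp (hT i j hi hj)).1
    have : blockSum N K (gT i j) a b ω
        ≤ cnt ω i j (Icc (a + 1) b) - κ * ∑ t ∈ Icc (a + 1) b, y (t - 1) := by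
      unfold cnt
      rw [Finset.mul_sum, ← Finset.sum_sub_distrib]
      refine Finset.sum_le_sum fun t ht => ?_
      rw [mem_Icc] at ht
      have hs : ∑ l ∈ range (N + 1), K (ω (t - 1)) l * gT i j (ω (t - 1)) l
          = K (ω (t - 1)) j * y (t - 1) := by
        unfold gT
        by_cases h : ω (t - 1) = i
        · simp only [h, true_and, mul_ite, mul_one, mul_zero, hy, if_true]
          rw [Finset.sum_ite_eq', if_pos (by simp; omega)]
        · simp [h, hy]
      rw [hs]
      have h5 := hKκ (ω (t - 1)) j (hω _ (by omega)) hj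
      have h6 := mul_le_mul_of_nonneg_right h5 (hy0 (t - 1))
      simp only [gT]; linarith
    linarith
  have := mul_le_mul_of_nonneg_left h3 hκ.le
  linarith

/-- What we want on one block. -/
def BlockGood (c r : ℝ) (d ε : ℝ) (a b n : ℕ) (ω : ℕ → ℕ) : Prop :=
  (∀ i j, i ≤ 1 → j ≤ 1 → d * n ≤ cnt ω i j (Icc (a + 1) b)) ∧
  |∑ t ∈ Icc (a + 1) b, (xR ω t - c - r * xR ω (t - 1))| ≤ ε * n ∧
  |∑ t ∈ Icc (a + 1) b, xR ω (t - 1) * (xR ω t - c - r * xR ω (t - 1))| ≤ ε * n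

lemma block_whp (N : ℕ) (hN : 1 ≤ N) (K : ℕ → ℕ → ℝ) (c r κ c1 : ℝ) (hκ : 0 < κ) (hc1 : 0 < c1)
    (hKκ : ∀ i j, i ≤ N → j ≤ 1 → κ ≤ K i j)
    (hmean : ∀ i, i ≤ N → ∑ j ∈ range (N + 1), K i j * (j : ℝ) = r * i + c)
    (μ : ℕ → Measure (ℕ → ℕ)) (a b : ℕ → ℕ) (hab : ∀ n, a n ≤ b n) (hbn : ∀ n, b n ≤ n)
    (hlen : ∀ᶠ n : ℕ in atTop, c1 * n ≤ (b n : ℝ) - a n)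
    (hsupp : Tendsto (fun n => μ n {ω | ¬ ∀ t ≤ n, ω t ≤ N}) atTop (nhds 0))
    (hlln : ∀ (g : ℕ → ℕ → ℝ) (ε : ℝ), 0 < ε →
      Tendsto (fun n : ℕ => μ n {ω | ε * n < |blockSum N K g (a n) (b n) ω|}) atTop (nhds 0))
    (ε : ℝ) (hε : 0 < ε) :
    Tendsto (fun n => μ n {ω | ¬ BlockGood c r (κ ^ 2 * c1 / 4) ε (a n) (b n) n ω})
      atTop (nhds 0) := by
  have t1 := hlln (fun _ j => (j : ℝ)) ε hε
  have t2 := hlln (fun i j => (i : ℝ) * j) ε hε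
  have t3 := tz_iUnion μ (fun (j : Fin 2) n =>
    {ω | κ * c1 / 4 * n < |blockSum N K (gV j) (a n) (b n) ω|})
    (fun j => hlln _ _ (by positivity))
  have t4 := tz_iUnion μ (fun (q : Fin 2 × Fin 2) n =>
    {ω | κ ^ 2 * c1 / 4 * n < |blockSum N K (gT q.1 q.2) (a n) (b n) ω|})
    (fun q => hlln _ _ (by positivity))
  refine tz_mono μ _ _ (tz_union μ _ _ hsupp (tz_union μ _ _ t1 (tz_union μ _ _ t2
    (tz_union μ _ _ t3 t4)))) ?_
  filter_upwards [hlen, tendsto_natCast_atTop_atTop.eventually_ge_atTop (4 / (κ * c1))]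
    with n hl hn4
  intro ω hbad
  by_contra hno
  apply hbad
  simp only [Set.mem_union, not_or, Set.mem_iUnion, not_exists, Set.mem_ofPred_eq, not_lt,
    not_not] at hno
  obtain ⟨hω, s1, s2, s3, s4⟩ := hno
  refine ⟨?_, ?_, ?_⟩
  · intro i j hi hj
    refine block_cnt N hN K κ c1 hκ hc1 hKκ (a n) (b n) n (hab n) (hbn n) hl hn4 ω hω ?_ ?_ i j hi hj
    · intro j hj
      exact s3 ⟨j, by omega⟩
    · intro i j hi hj
      exact s4 (⟨i, by omega⟩, ⟨j, by omega⟩)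
  · refine le_trans (le_of_eq (congrArg abs ?_)) s1
    unfold blockSum
    refine Finset.sum_congr rfl fun t ht => ?_
    rw [mem_Icc] at ht
    have := hbn n
    rw [hmean _ (hω (t - 1) (by omega))]
    simp only [xR]; ring
  · refine le_trans (le_of_eq (congrArg abs ?_)) s2
    unfold blockSum
    refine Finset.sum_congr rfl fun t ht => ?_
    rw [mem_Icc] at ht
    have := hbn n
    have e : ∑ l ∈ range (N + 1), K (ω (t - 1)) l * ((ω (t - 1) : ℝ) * l)
        = (ω (t - 1) : ℝ) * ∑ l ∈ range (N + 1), K (ω (t - 1)) l * (l : ℝ) := by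
      rw [Finset.mul_sum]
      exact Finset.sum_congr rfl fun l _ => by ring
    rw [e, hmean _ (hω (t - 1) (by omega))]
    simp only [xR]; ring

lemma exists_kappa (N : ℕ) (hN : 1 ≤ N) (ρ p : ℝ) (hp0 : 0 < p) (hp1 : p < 1)
    (hl : max (-(p / (1 - p))) (-((1 - p) / p)) < ρ) (hu : ρ < 1) :
    ∃ κ : ℝ, 0 < κ ∧ ∀ i j, i ≤ N → j ≤ 1 → κ ≤ barK N ρ p i j := by
  obtain ⟨q, hq, hmin⟩ := Finset.exists_min_image (range (N + 1) ×ˢ range 2)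
    (fun q : ℕ × ℕ => barK N ρ p q.1 q.2) ⟨(0, 0), by simp⟩
  simp only [mem_product, mem_range] at hq
  refine ⟨barK N ρ p q.1 q.2, barK_pos N ρ p hp0 hp1 hl hu _ _ (by omega) (by omega), ?_⟩
  intro i j hi hj
  exact hmin (i, j) (by simp only [mem_product, mem_range]; omega)

/-- **Divergence of the CUSUM statistic under the alternative (Theorem 3, part 2).**
If the data follow a BAR(1) model with parameters `(ρ₁, p₁)` up to time `⌊nλ⌋` and with
different parameters `(ρ₂, p₂)` afterwards, then `C_n^{CLS} → +∞` in probability. -/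
theorem cusum_diverges_under_alternative
    (N : ℕ) (hN : 1 ≤ N) (p₁ ρ₁ p₂ ρ₂ : ℝ)
    (hp₁0 : 0 < p₁) (hp₁1 : p₁ < 1)
    (hρ₁l : max (-(p₁ / (1 - p₁))) (-((1 - p₁) / p₁)) < ρ₁) (hρ₁u : ρ₁ < 1)
    (hp₂0 : 0 < p₂) (hp₂1 : p₂ < 1)
    (hρ₂l : max (-(p₂ / (1 - p₂))) (-((1 - p₂) / p₂)) < ρ₂) (hρ₂u : ρ₂ < 1)
    (hne : (ρ₁, p₁) ≠ (ρ₂, p₂))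
    (lam : ℝ) (hlam0 : 0 < lam) (hlam1 : lam < 1)
    (μ : ℕ → Measure (ℕ → ℕ)) (hprob : ∀ n, IsProbabilityMeasure (μ n))
    (hμ : ∀ (n : ℕ) (x : ℕ → ℕ),
      μ n {ω | ∀ t ≤ n, ω t = x t} =
        ENNReal.ofReal (binomPMF N p₁ (x 0) *
          (∏ t ∈ Finset.Icc 1 ⌊(n : ℝ) * lam⌋₊, barK N ρ₁ p₁ (x (t - 1)) (x t)) *
          ∏ t ∈ Finset.Icc (⌊(n : ℝ) * lam⌋₊ + 1) n, barK N ρ₂ p₂ (x (t - 1)) (x t)))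
    (k₀ : ℕ) (hk₀ : 1 ≤ k₀) (M : ℝ) (hM : 0 < M) :
    Tendsto (fun n : ℕ => μ n {ω | cusumCLS N k₀ n (xR ω) ≤ M}) atTop (nhds 0) := by
  set m : ℕ → ℕ := fun n => ⌊(n : ℝ) * lam⌋₊ with hm
  have hmn : ∀ n, m n ≤ n := by
    intro n
    refine Nat.floor_le_of_le ?_
    have : (0 : ℝ) ≤ n := by positivity
    nlinarith
  have K1 := barK_isKer N ρ₁ p₁ hp₁0 hp₁1 hρ₁l hρ₁u
  have K2 := barK_isKer N ρ₂ p₂ hp₂0 hp₂1 hρ₂l hρ₂u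
  obtain ⟨κ₁, hκ₁, hκ₁'⟩ := exists_kappa N hN ρ₁ p₁ hp₁0 hp₁1 hρ₁l hρ₁u
  obtain ⟨κ₂, hκ₂, hκ₂'⟩ := exists_kappa N hN ρ₂ p₂ hp₂0 hp₂1 hρ₂l hρ₂u
  obtain ⟨κ, hκ, hκa, hκb⟩ : ∃ κ, 0 < κ ∧ κ ≤ κ₁ ∧ κ ≤ κ₂ :=
    ⟨min κ₁ κ₂, lt_min hκ₁ hκ₂, min_le_left _ _, min_le_right _ _⟩
  obtain ⟨c1, hc1, hc1a, hc1b⟩ : ∃ c, 0 < c ∧ c ≤ lam / 2 ∧ c ≤ 1 - lam :=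
    ⟨min (lam / 2) (1 - lam), lt_min (by linarith) (by linarith), min_le_left _ _, min_le_right _ _⟩
  set P : ℕ → ℕ → ℕ → ℕ → ℝ := fun n t =>
    if t ≤ m n then barK N ρ₁ p₁ else barK N ρ₂ p₂ with hP
  have hPK : ∀ n t, IsKer N (P n t) := by
    intro n t
    simp only [hP]
    split_ifs
    · exact K1
    · exact K2
  have hμ' : ∀ n (x : ℕ → ℕ), μ n {ω | ∀ t ≤ n, ω t = x t}
      = ENNReal.ofReal (pathW (binomPMF N p₁) (P n) n x) := by
    intro n x
    rw [hμ n x, pathW, mul_assoc]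
    congr 2
    have hu : Icc 1 n = Icc 1 (m n) ∪ Icc (m n + 1) n := by
      have := hmn n
      ext t; simp only [mem_union, mem_Icc]; omega
    have hd : Disjoint (Icc 1 (m n)) (Icc (m n + 1) n) := by
      rw [Finset.disjoint_left]
      intro t; simp only [mem_Icc]; omega
    rw [hu, Finset.prod_union hd]
    congr 1
    · refine Finset.prod_congr rfl fun t ht => ?_
      rw [mem_Icc] at ht
      simp only [hP]; rw [if_pos ht.2]
    · refine Finset.prod_congr rfl fun t ht => ?_
      rw [mem_Icc] at ht
      simp only [hP]; rw [if_neg (by omega)]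
  have hπ := binomPMF_nonneg N p₁ hp₁0 hp₁1
  have hπN := binomPMF_zero N p₁
  have hπ1 := binom_sum N p₁
  have hsupp : Tendsto (fun n => μ n {ω | ¬ ∀ t ≤ n, ω t ≤ N}) atTop (nhds 0) := by
    have : (fun n => μ n {ω | ¬ ∀ t ≤ n, ω t ≤ N}) = fun _ => 0 := by
      funext n
      exact path_support N _ (P n) hπ (fun t => (hPK n t).nonneg) hπN (fun t => (hPK n t).zero) n
        (μ n) (hμ' n)
    rw [this]; exact tendsto_const_nhds
  obtain ⟨ε, hε, n0, hdet⟩ := deterministic N hN (N * p₁ * (1 - ρ₁)) ρ₁ (N * p₂ * (1 - ρ₂)) ρ₂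
    (κ ^ 2 * c1 / 4) (by positivity) (by
      rintro ⟨h1, h2⟩
      apply hne
      subst h2
      have hN0 : (0 : ℝ) < N := by exact_mod_cast hN
      have h3 : (1 - ρ₁) ≠ 0 := by linarith
      have h4 := mul_left_cancel₀ hN0.ne' (mul_right_cancel₀ h3 h1)
      rw [h4]) k₀ M
  have w1 := block_whp N hN (barK N ρ₁ p₁) (N * p₁ * (1 - ρ₁)) ρ₁ κ c1 hκ hc1
    (fun i j hi hj => hκa.trans (hκ₁' i j hi hj)) (barK_mean N ρ₁ p₁) μ (fun _ => 0) m
    (fun _ => Nat.zero_le _) hmn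
    (by
      filter_upwards [tendsto_natCast_atTop_atTop.eventually_ge_atTop (2 / lam)] with n hn
      rw [div_le_iff₀ hlam0] at hn
      have h1 : (n : ℝ) * lam < m n + 1 := Nat.lt_floor_add_one _
      have h2 : c1 * n ≤ lam / 2 * n := by gcongr
      push_cast
      linarith) hsupp
    (fun g ε hε => lln_block N _ hπ hπN hπ1 P hPK μ hμ' _ K1 _ _ (by
      intro n t ht
      rw [mem_Icc] at ht
      have := hmn n
      refine ⟨by omega, ?_⟩
      simp only [hP]; rw [if_pos ht.2]) g ε hε) ε hε
  have w2 := block_whp N hN (barK N ρ₂ p₂) (N * p₂ * (1 - ρ₂)) ρ₂ κ c1 hκ hc1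
    (fun i j hi hj => hκb.trans (hκ₂' i j hi hj)) (barK_mean N ρ₂ p₂) μ m (fun n => n)
    hmn (fun _ => le_rfl)
    (by
      refine Eventually.of_forall fun n => ?_
      have h1 : (m n : ℝ) ≤ n * lam := Nat.floor_le (by positivity)
      have h2 : c1 * n ≤ (1 - lam) * n := by gcongr
      linarith) hsupp
    (fun g ε hε => lln_block N _ hπ hπN hπ1 P hPK μ hμ' _ K2 _ _ (by
      intro n t ht
      rw [mem_Icc] at ht
      refine ⟨by omega, ?_⟩
      simp only [hP]; rw [if_neg (by omega)]) g ε hε) ε hε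
  refine tz_mono μ _ _ (tz_union μ _ _ hsupp (tz_union μ _ _ w1 w2)) ?_
  filter_upwards [eventually_ge_atTop n0] with n hn
  intro ω hbad
  by_contra hno
  simp only [Set.mem_union, not_or, Set.mem_ofPred_eq, not_not] at hno
  obtain ⟨hω, ⟨a1, a2, a3⟩, ⟨b1, b2, b3⟩⟩ := hno
  have := hdet n hn (m n) (hmn n) ω ⟨hω, a1, b1, a2, a3, b2, b3⟩
  exact absurd hbad (not_le.mpr this)
end
end

section
/- (Conditional mean of the BAR(1) model.) For every i ∈ S, the mean of the BAR(1) kernel at state i satisfies Σ_{j=0}^N j · K(i,{j}) = ρ i + N p(1−ρ). -/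
open MeasureTheory Filter Finset Matrix

noncomputable section

/-- The binomial weights sum to one. -/
lemma bar_binom_sum (n : ℕ) (a : ℝ) :
    ∑ k ∈ Finset.range (n + 1), (Nat.choose n k : ℝ) * a ^ k * (1 - a) ^ (n - k) = 1 := by
  have h := congrArg (Polynomial.eval a) (bernsteinPolynomial.sum ℝ n)
  simpa [Polynomial.eval_finsetSum, bernsteinPolynomial] using h

/-- The mean of the binomial weights. -/
lemma bar_binom_mean (n : ℕ) (a : ℝ) :
    ∑ k ∈ Finset.range (n + 1), (k : ℝ) * ((Nat.choose n k : ℝ) * a ^ k * (1 - a) ^ (n - k))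
      = n * a := by
  have h := congrArg (Polynomial.eval a) (bernsteinPolynomial.sum_smul ℝ n)
  simpa [Polynomial.eval_finsetSum, bernsteinPolynomial] using h

/-- The kernel mean as a double sum over two independent binomials. -/
lemma bar_reindex (N : ℕ) (ρ p : ℝ) (i : ℕ) (hi : i ≤ N) :
    ∑ j ∈ Finset.range (N + 1), (j : ℝ) * barK N ρ p i j
      = ∑ k ∈ Finset.range (i + 1), ∑ m ∈ Finset.range (N - i + 1),
        ((k : ℝ) + m) *
        (((Nat.choose i k : ℝ) * (p * (1 - ρ) + ρ) ^ k * (1 - (p * (1 - ρ) + ρ)) ^ (i - k)) *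
        ((Nat.choose (N - i) m : ℝ) * (p * (1 - ρ)) ^ m * (1 - p * (1 - ρ)) ^ (N - i - m))) := by
  simp only [barK, Finset.mul_sum]
  rw [Finset.sum_sigma', Finset.sum_sigma']
  refine Finset.sum_bij' (fun x _ => ⟨x.2, x.1 - x.2⟩) (fun y _ => ⟨y.1 + y.2, y.1⟩) ?_ ?_ ?_ ?_ ?_
  · rintro ⟨j, k⟩ h
    simp only [Finset.mem_sigma, Finset.mem_range, Finset.mem_Icc, le_min_iff] at h ⊢
    omega
  · rintro ⟨k, m⟩ h
    simp only [Finset.mem_sigma, Finset.mem_range, Finset.mem_Icc, le_min_iff] at h ⊢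
    omega
  · rintro ⟨j, k⟩ h
    simp only [Finset.mem_sigma, Finset.mem_range, Finset.mem_Icc, le_min_iff] at h
    have : k + (j - k) = j := by omega
    simp [this]
  · rintro ⟨k, m⟩ h
    simp
  · rintro ⟨j, k⟩ h
    simp only [Finset.mem_sigma, Finset.mem_range, Finset.mem_Icc, le_min_iff] at h
    have h1 : N + k - (i + j) = N - i - (j - k) := by omega
    have h2 : (j : ℝ) = (k : ℝ) + ((j - k : ℕ) : ℝ) := by
      rw [← Nat.cast_add]; congr 1; omega
    simp only [h1]
    rw [← h2]
    ring

/-- **Conditional mean of the BAR(1) model.**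
For every state `i ∈ S = {0, …, N}`, `Σ_{j=0}^N j K(i,{j}) = ρ i + N p (1-ρ)`. -/
theorem bar_conditional_mean
    (N : ℕ) (hN : 1 ≤ N) (p ρ : ℝ) (hp0 : 0 < p) (hp1 : p < 1)
    (hρl : max (-(p / (1 - p))) (-((1 - p) / p)) < ρ) (hρu : ρ < 1) :
    ∀ i ≤ N, ∑ j ∈ Finset.range (N + 1), (j : ℝ) * barK N ρ p i j
      = ρ * i + N * p * (1 - ρ) := by
  intro i hi
  rw [bar_reindex N ρ p i hi]
  have e1 := bar_binom_sum i (p * (1 - ρ) + ρ)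
  have e2 := bar_binom_mean i (p * (1 - ρ) + ρ)
  have e3 := bar_binom_sum (N - i) (p * (1 - ρ))
  have e4 := bar_binom_mean (N - i) (p * (1 - ρ))
  have inner : ∀ (k : ℕ) (A : ℝ), ∑ m ∈ Finset.range (N - i + 1), ((k : ℝ) + m) * (A *
      ((Nat.choose (N - i) m : ℝ) * (p * (1 - ρ)) ^ m * (1 - p * (1 - ρ)) ^ (N - i - m)))
      = k * A + A * (((N - i : ℕ) : ℝ) * (p * (1 - ρ))) := by
    intro k A
    have e5 := congrArg (fun t => (k : ℝ) * A * t) e3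
    simp only [mul_one ((k : ℝ) * A)] at e5
    rw [← e4, ← e5, Finset.mul_sum, Finset.mul_sum, ← Finset.sum_add_distrib]
    exact Finset.sum_congr rfl fun m _ => by ring
  simp only [inner]
  rw [Finset.sum_add_distrib, ← Finset.sum_mul, e1, e2, Nat.cast_sub hi]
  ring
end
end

section
/- (h-step transition probabilities.) For every integer h ≥ 1 and all i, j ∈ S, the (i,j) entry of the h-th power of the transition matrix [K(i,{j})]_{i,j∈S} equals Σ_{k=max{0,i+j−N}}^{min{i,j}} C(i,k) C(N−i,j−k) α_h^k (1−α_h)^{i−k} β_h^{j−k} (1−β_h)^{N−i−j+k}, where β_h = p(1−ρ^h) and α_h = β_h + ρ^h. -/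
open MeasureTheory Filter Finset Matrix

noncomputable section

/-- The BAR(1) transition matrix on `S = {0, …, N}`. -/
def barMat (N : ℕ) (ρ p : ℝ) : Matrix (Fin (N + 1)) (Fin (N + 1)) ℝ :=
  Matrix.of fun i j => barK N ρ p (i : ℕ) (j : ℕ)

open Polynomial in
lemma gen_aux {R : Type*} [CommRing R] (N i : ℕ) (hi : i ≤ N) (a c b d u v : R) :
    ∑ j ∈ Finset.range (N + 1), (∑ k ∈ Finset.Icc (i + j - N) (min i j),
      (Nat.choose i k : R) * (Nat.choose (N - i) (j - k)) *
      a ^ k * c ^ (i - k) * b ^ (j - k) * d ^ (N + k - (i + j))) * (u ^ j * v ^ (N - j))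
    = (a * u + c * v) ^ i * (b * u + d * v) ^ (N - i) := by
  rw [add_pow, add_pow, Finset.sum_mul_sum]
  simp only [Finset.sum_mul]
  rw [Finset.sum_sigma', Finset.sum_sigma']
  refine Finset.sum_bij' (fun x _ => ⟨x.2, x.1 - x.2⟩) (fun y _ => ⟨y.1 + y.2, y.1⟩) ?_ ?_ ?_ ?_ ?_
  · rintro ⟨j, k⟩ h
    simp only [Finset.mem_sigma, Finset.mem_range, Finset.mem_Icc, le_min_iff] at h ⊢
    omega
  · rintro ⟨k, m⟩ h
    simp only [Finset.mem_sigma, Finset.mem_range, Finset.mem_Icc, le_min_iff] at h ⊢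
    omega
  · rintro ⟨j, k⟩ h
    simp only [Finset.mem_sigma, Finset.mem_range, Finset.mem_Icc, le_min_iff] at h
    have : k + (j - k) = j := by omega
    simp [this]
  · rintro ⟨k, m⟩ h
    simp
  · rintro ⟨j, k⟩ h
    simp only [Finset.mem_sigma, Finset.mem_range, Finset.mem_Icc, le_min_iff] at h
    obtain ⟨m, rfl⟩ : ∃ m, j = k + m := ⟨j - k, by omega⟩
    obtain ⟨q, rfl⟩ : ∃ q, i = k + q := ⟨i - k, by omega⟩
    obtain ⟨r, rfl⟩ : ∃ r, N = k + q + m + r := ⟨N - (k + q + m), by omega⟩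
    have e1 : k + q + m + r + k - (k + q + (k + m)) = r := by omega
    have e2 : k + q + m + r - (k + m) = q + r := by omega
    have e3 : k + q + m + r - (k + q) = m + r := by omega
    have e4 : k + m - k = m := by omega
    have e5 : k + q - k = q := by omega
    have e6 : m + r - m = r := by omega
    simp only [e1, e2, e3, e4, e5, e6]
    ring

open Polynomial in
lemma barK_gen (N i : ℕ) (hi : i ≤ N) (ρ p : ℝ) (u v : ℝ[X]) :
    ∑ j ∈ Finset.range (N + 1), C (barK N ρ p i j) * (u ^ j * v ^ (N - j))
    = (C (p * (1 - ρ) + ρ) * u + C (1 - (p * (1 - ρ) + ρ)) * v) ^ i *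
      (C (p * (1 - ρ)) * u + C (1 - p * (1 - ρ)) * v) ^ (N - i) := by
  rw [← gen_aux N i hi]
  refine Finset.sum_congr rfl fun j _ => ?_
  simp only [barK, map_sum, map_mul, map_pow, map_natCast]

open Polynomial in
lemma barK_mul (N i j : ℕ) (hi : i ≤ N) (hj : j ≤ N) (ρ σ p : ℝ) :
    ∑ l ∈ Finset.range (N + 1), barK N ρ p i l * barK N σ p l j = barK N (ρ * σ) p i j := by
  have key : ∑ l ∈ Finset.range (N + 1), C (barK N ρ p i l) *
      (∑ j ∈ Finset.range (N + 1), C (barK N σ p l j) * ((X : ℝ[X]) ^ j * 1 ^ (N - j)))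
      = ∑ j ∈ Finset.range (N + 1), C (barK N (ρ * σ) p i j) * ((X : ℝ[X]) ^ j * 1 ^ (N - j)) := by
    rw [barK_gen N i hi]
    rw [Finset.sum_congr rfl fun l hl => by
      rw [barK_gen N l (by simpa [Nat.lt_succ_iff] using hl)]]
    rw [barK_gen N i hi]
    congr 2
    · simp only [map_sub, map_add, map_mul, map_one]; ring
    · simp only [map_sub, map_add, map_mul, map_one]; ring
  have := congrArg (fun q => q.coeff j) key
  have hjlt : j < N + 1 := by omega
  simpa [finsetSum_coeff, coeff_X_pow, hjlt] using this

/-- **h-step transition probabilities.**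
For every `h ≥ 1` and all `i, j ∈ S`, the `(i,j)` entry of the `h`-th power of the
transition matrix equals
`Σ_k C(i,k) C(N-i,j-k) α_h^k (1-α_h)^{i-k} β_h^{j-k} (1-β_h)^{N-i-j+k}`,
where `β_h = p(1-ρ^h)` and `α_h = β_h + ρ^h`. -/
theorem bar_hstep_transition
    (N : ℕ) (hN : 1 ≤ N) (p ρ : ℝ) (hp0 : 0 < p) (hp1 : p < 1)
    (hρl : max (-(p / (1 - p))) (-((1 - p) / p)) < ρ) (hρu : ρ < 1) :
    ∀ h : ℕ, 1 ≤ h → ∀ i j : Fin (N + 1),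
      (barMat N ρ p ^ h) i j =
        ∑ k ∈ Finset.Icc ((i : ℕ) + (j : ℕ) - N) (min (i : ℕ) (j : ℕ)),
          (Nat.choose (i : ℕ) k : ℝ) * (Nat.choose (N - (i : ℕ)) ((j : ℕ) - k)) *
            (p * (1 - ρ ^ h) + ρ ^ h) ^ k *
            (1 - (p * (1 - ρ ^ h) + ρ ^ h)) ^ ((i : ℕ) - k) *
            (p * (1 - ρ ^ h)) ^ ((j : ℕ) - k) *
            (1 - p * (1 - ρ ^ h)) ^ (N + k - ((i : ℕ) + (j : ℕ))) := by
  have main : ∀ h : ℕ, barMat N ρ p ^ (h + 1) = barMat N (ρ ^ (h + 1)) p := by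
    intro h
    induction h with
    | zero => simp
    | succ h ih =>
      rw [pow_succ, ih, pow_succ ρ (h + 1)]
      ext i j
      rw [Matrix.mul_apply]
      simp only [barMat, Matrix.of_apply]
      rw [← barK_mul N i j (by omega) (by omega)]
      exact Fin.sum_univ_eq_sum_range
        (fun l => barK N (ρ ^ (h + 1)) p i l * barK N ρ p l j) (N + 1)
  intro h hh i j
  obtain ⟨h, rfl⟩ : ∃ g, h = g + 1 := ⟨h - 1, by omega⟩
  rw [main]
  rfl
end
end

section
/- (Stationarity of the binomial distribution.) The Binomial(N, p) distribution is invariant for the BAR(1) kernel: for every j ∈ S, Σ_{i=0}^N C(N,i) p^i (1−p)^{N−i} K(i,{j}) = C(N,j) p^j (1−p)^{N−j}. -/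
open MeasureTheory Filter Finset Matrix

noncomputable section

lemma bar_choose (k a b c : ℕ) :
    (Nat.choose (k + a + b + c) (k + a) : ℝ) * Nat.choose (k + a) k * Nat.choose (b + c) b
      * (k.factorial * a.factorial * b.factorial * c.factorial) = (k + a + b + c).factorial := by
  have h1 := Nat.add_choose_mul_factorial_mul_factorial (k + a) (b + c)
  rw [Nat.choose_symm_add.symm] at h1
  have h2 := Nat.add_choose_mul_factorial_mul_factorial k a
  rw [Nat.choose_symm_add.symm] at h2
  have h3 := Nat.add_choose_mul_factorial_mul_factorial b c
  rw [Nat.choose_symm_add.symm] at h3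
  rw [show k + a + b + c = k + a + (b + c) by ring, ← h1]
  push_cast
  have h2' : (Nat.choose (k + a) k : ℝ) * k.factorial * a.factorial = (k + a).factorial := by
    exact_mod_cast h2
  have h3' : (Nat.choose (b + c) b : ℝ) * b.factorial * c.factorial = (b + c).factorial := by
    exact_mod_cast h3
  rw [← h2', ← h3']
  ring

lemma bar_choose_symm (k a b c : ℕ) :
    (Nat.choose (k + a + b + c) (k + a) : ℝ) * Nat.choose (k + a) k * Nat.choose (b + c) b
      = (Nat.choose (k + a + b + c) (k + b) : ℝ) * Nat.choose (k + b) k * Nat.choose (a + c) a := by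
  have h1 := bar_choose k a b c
  have h2 := bar_choose k b a c
  rw [show k + b + a + c = k + a + b + c by ring] at h2
  have hz : ((k.factorial : ℝ) * a.factorial * b.factorial * c.factorial) ≠ 0 := by positivity
  apply mul_right_cancel₀ hz
  rw [h1, ← h2]
  ring

lemma bar_balance (N : ℕ) (p ρ : ℝ) (i j : ℕ) (hi : i ≤ N) (hj : j ≤ N) :
    binomPMF N p i * barK N ρ p i j = binomPMF N p j * barK N ρ p j i := by
  unfold barK binomPMF
  rw [Finset.mul_sum, Finset.mul_sum, add_comm j i, min_comm j i]
  apply Finset.sum_congr rfl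
  intro k hk
  rw [Finset.mem_Icc, le_min_iff] at hk
  obtain ⟨hk1, hk2, hk3⟩ := hk
  obtain ⟨a, rfl⟩ := Nat.exists_eq_add_of_le hk2
  obtain ⟨b, rfl⟩ := Nat.exists_eq_add_of_le hk3
  obtain ⟨c, rfl⟩ : ∃ c, N = k + a + b + c := ⟨N - (k + a + b), by omega⟩
  have e1 : k + a + b + c - (k + a) = b + c := by omega
  have e2 : k + a + b + c - (k + b) = a + c := by omega
  have e3 : k + a + b + c + k - (k + a + (k + b)) = c := by omega
  have e4 : 1 - (p * (1 - ρ) + ρ) = (1 - p) * (1 - ρ) := by ring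
  rw [e1, e2, e3, e4, Nat.add_sub_cancel_left, Nat.add_sub_cancel_left]
  have h := bar_choose_symm k a b c
  generalize 1 - p * (1 - ρ) = z
  generalize p * (1 - ρ) + ρ = y
  generalize 1 - ρ = x
  generalize 1 - p = q
  rw [mul_pow, mul_pow, mul_pow, mul_pow]
  simp only [pow_add]
  linear_combination (p ^ k * p ^ a * q ^ b * q ^ c * y ^ k * q ^ a * x ^ a * p ^ b * x ^ b * z ^ c) * h

lemma bar_row (N : ℕ) (p ρ : ℝ) (i : ℕ) (hi : i ≤ N) :
    ∑ j ∈ Finset.range (N + 1), barK N ρ p i j = 1 := by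
  unfold barK
  generalize p * (1 - ρ) + ρ = y
  generalize p * (1 - ρ) = z
  have h1 : (∑ k ∈ Finset.range (i + 1), y ^ k * (1 - y) ^ (i - k) * (i.choose k : ℝ)) = 1 := by
    rw [← add_pow]; simp
  have h2 : (∑ k ∈ Finset.range (N - i + 1),
      z ^ k * (1 - z) ^ (N - i - k) * ((N - i).choose k : ℝ)) = 1 := by
    rw [← add_pow]; simp
  have h3 := congrArg₂ (· * ·) h1 h2
  simp only [mul_one] at h3
  refine Eq.trans ?_ h3
  rw [Finset.sum_mul_sum, Finset.sum_sigma', Finset.sum_sigma']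
  refine Finset.sum_bij' (fun x _ => ⟨x.2, x.1 - x.2⟩) (fun x _ => ⟨x.1 + x.2, x.1⟩) ?_ ?_ ?_ ?_ ?_
  · rintro ⟨j, k⟩ h
    simp only [Finset.mem_sigma, Finset.mem_range, Finset.mem_Icc, le_min_iff] at h ⊢
    omega
  · rintro ⟨j, k⟩ h
    simp only [Finset.mem_sigma, Finset.mem_range, Finset.mem_Icc, le_min_iff] at h ⊢
    omega
  · rintro ⟨j, k⟩ h
    simp only [Finset.mem_sigma, Finset.mem_range, Finset.mem_Icc, le_min_iff] at h
    have : k + (j - k) = j := by omega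
    simp [this]
  · rintro ⟨j, k⟩ h
    simp
  · rintro ⟨j, k⟩ h
    simp only [Finset.mem_sigma, Finset.mem_range, Finset.mem_Icc, le_min_iff] at h
    have : N + k - (i + j) = N - i - (j - k) := by omega
    simp only [this]
    ring

/-- **Stationarity of the binomial distribution.**
The Binomial(N,p) distribution is invariant for the BAR(1) kernel:
for every `j ∈ S`, `Σ_{i=0}^N π({i}) K(i,{j}) = π({j})`. -/
theorem binomial_invariant
    (N : ℕ) (hN : 1 ≤ N) (p ρ : ℝ) (hp0 : 0 < p) (hp1 : p < 1)
    (hρl : max (-(p / (1 - p))) (-((1 - p) / p)) < ρ) (hρu : ρ < 1) :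
    ∀ j ≤ N, ∑ i ∈ Finset.range (N + 1), binomPMF N p i * barK N ρ p i j
      = binomPMF N p j := by
  intro j hj
  rw [Finset.sum_congr rfl (fun i hi => bar_balance N p ρ i j
    (Nat.lt_succ_iff.mp (Finset.mem_range.mp hi)) hj), ← Finset.mul_sum, bar_row N p ρ j hj, mul_one]
end
end

section
/- (Ergodicity of the BAR(1) process.) The shift map T : S^ℕ → S^ℕ, (T x)_t = x_{t+1}, is ergodic with respect to the trajectory law μ of the BAR(1) chain started from Binomial(N, p): T preserves μ and every measurable set A with T⁻¹A = A satisfies μ(A) ∈ {0, 1}. -/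
open MeasureTheory Filter Finset Matrix

noncomputable section

def cyl (n : ℕ) (x : ℕ → ℕ) : Set (ℕ → ℕ) := {ω | ∀ t ≤ n, ω t = x t}

def extFin (n : ℕ) (l : Fin (n + 1) → ℕ) (t : ℕ) : ℕ :=
  if h : t < n + 1 then l ⟨t, h⟩ else 0

lemma measurableSet_coord (t a : ℕ) : MeasurableSet {ω : ℕ → ℕ | ω t = a} :=
  measurableSet_eq_fun (measurable_pi_apply t) measurable_const

lemma measurableSet_cyl (n : ℕ) (x : ℕ → ℕ) : MeasurableSet (cyl n x) := by
  have : cyl n x = ⋂ t : ℕ, ⋂ _ : t ≤ n, {ω : ℕ → ℕ | ω t = x t} := by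
    ext ω; simp [cyl]
  rw [this]
  exact MeasurableSet.iInter fun t => MeasurableSet.iInter fun _ => measurableSet_coord t _

def shiftN (n : ℕ) (ω : ℕ → ℕ) : ℕ → ℕ := fun t => ω (n + t)

lemma measurable_shiftN (n : ℕ) : Measurable (shiftN n) :=
  measurable_pi_lambda _ fun t => measurable_pi_apply (n + t)

lemma isPiSystem_cyl : IsPiSystem {s | ∃ n x, s = cyl n x} := by
  rintro _ ⟨n, x, rfl⟩ _ ⟨m, y, rfl⟩ ⟨ω, h1, h2⟩
  refine ⟨max n m, ω, ?_⟩
  ext η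
  constructor
  · rintro ⟨h3, h4⟩ t ht
    rcases le_max_iff.1 ht with h | h
    · rw [h3 t h, h1 t h]
    · rw [h4 t h, h2 t h]
  · intro h
    refine ⟨fun t ht => ?_, fun t ht => ?_⟩
    · rw [h t (le_max_of_le_left ht), h1 t ht]
    · rw [h t (le_max_of_le_right ht), h2 t ht]

lemma generate_cyl :
    (MeasurableSpace.pi : MeasurableSpace (ℕ → ℕ)) =
      MeasurableSpace.generateFrom {s | ∃ n x, s = cyl n x} := by
  apply le_antisymm
  · refine iSup_le fun t => ?_
    rintro _ ⟨s, -, rfl⟩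
    have : (fun ω : ℕ → ℕ => ω t) ⁻¹' s =
        ⋃ l : Fin (t + 1) → ℕ, ⋃ _ : extFin t l t ∈ s, cyl t (extFin t l) := by
      ext ω
      simp only [Set.mem_preimage, Set.mem_iUnion, exists_prop]
      constructor
      · intro h
        refine ⟨fun i => ω i, by simpa [extFin] using h, fun u hu => ?_⟩
        simp [extFin, Nat.lt_succ_of_le hu]
      · rintro ⟨l, hl, h⟩
        rw [h t le_rfl]; exact hl
    rw [this]
    refine MeasurableSet.iUnion fun l => MeasurableSet.iUnion fun _ => ?_
    exact MeasurableSpace.measurableSet_generateFrom ⟨_, _, rfl⟩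
  · refine MeasurableSpace.generateFrom_le ?_
    rintro _ ⟨n, x, rfl⟩
    exact measurableSet_cyl n x

lemma measure_split (ν : Measure (ℕ → ℕ)) (S : Set (ℕ → ℕ)) (hS : MeasurableSet S) (t : ℕ) :
    ν S = ∑' a : ℕ, ν (S ∩ {ω | ω t = a}) := by
  rw [← measure_iUnion]
  · congr 1; ext ω; simp
  · intro a b hab
    refine Set.disjoint_left.2 ?_
    rintro ω ⟨_, h1⟩ ⟨_, h2⟩
    exact hab (h1.symm.trans h2)
  · exact fun a => hS.inter (measurableSet_coord t a)

lemma cyl_zero (x : ℕ → ℕ) : cyl 0 x = {ω | ω 0 = x 0} := by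
  ext ω; simp [cyl]

lemma measure_ext_cyl (ν₁ ν₂ : Measure (ℕ → ℕ)) [IsFiniteMeasure ν₁]
    (h : ∀ n x, ν₁ (cyl n x) = ν₂ (cyl n x)) : ν₁ = ν₂ := by
  refine ext_of_generate_finite _ generate_cyl isPiSystem_cyl ?_ ?_
  · rintro _ ⟨n, x, rfl⟩; exact h n x
  · rw [measure_split ν₁ _ MeasurableSet.univ 0, measure_split ν₂ _ MeasurableSet.univ 0]
    refine tsum_congr fun a => ?_
    have := h 0 (fun _ => a)
    rw [cyl_zero] at this
    simpa using this

lemma ergodic_of_chain (N : ℕ) (q : ℕ → ℝ) (K : ℕ → ℕ → ℝ)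
    (hq0 : ∀ i, 0 ≤ q i) (hqpos : ∀ i ≤ N, 0 < q i) (hqz : ∀ i, N < i → q i = 0)
    (hK0 : ∀ i j, 0 ≤ K i j) (hKpos : ∀ i ≤ N, ∀ j ≤ N, 0 < K i j)
    (hKz : ∀ i ≤ N, ∀ j, N < j → K i j = 0)
    (rev : ∀ i ≤ N, ∀ j ≤ N, q i * K i j = q j * K j i)
    (μ : Measure (ℕ → ℕ)) [IsProbabilityMeasure μ]
    (hμ : ∀ (n : ℕ) (x : ℕ → ℕ),
      μ (cyl n x) = ENNReal.ofReal (q (x 0) * ∏ t ∈ Finset.range n, K (x t) (x (t + 1)))) :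
    Ergodic (shiftN 1) μ := by
  have hP0 : ∀ n (x : ℕ → ℕ), 0 ≤ ∏ t ∈ Finset.range n, K (x t) (x (t + 1)) :=
    fun n x => Finset.prod_nonneg fun t _ => hK0 _ _
  have hμ0 : ∀ i, μ {ω | ω 0 = i} = ENNReal.ofReal (q i) := fun i => by
    have := hμ 0 (fun _ => i)
    rw [cyl_zero] at this
    simpa using this
  have hμ1 : ∀ i j, μ ({ω | ω 0 = i} ∩ {ω | ω 1 = j}) = ENNReal.ofReal (q i * K i j) := by
    intro i j
    have := hμ 1 (fun t => if t = 0 then i else j)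
    have h2 : cyl 1 (fun t => if t = 0 then i else j) = {ω | ω 0 = i} ∩ {ω | ω 1 = j} := by
      ext ω
      simp only [cyl, Set.mem_ofPred_eq, Set.mem_inter_iff]
      constructor
      · intro h; exact ⟨by simpa using h 0 (by simp), by simpa using h 1 le_rfl⟩
      · rintro ⟨h, h'⟩ t ht
        interval_cases t <;> simp [h, h']
    rw [h2] at this
    simpa using this
  -- row sums
  have row : ∀ i ≤ N, ∑ j ∈ Finset.range (N + 1), K i j = 1 := by
    intro i hi
    have h := measure_split μ _ (measurableSet_coord 0 i) 1
    simp only [hμ1, hμ0] at h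
    rw [tsum_eq_sum (s := Finset.range (N + 1)), ← ENNReal.ofReal_sum_of_nonneg] at h
    · rw [ENNReal.ofReal_eq_ofReal_iff (hq0 _)
        (Finset.sum_nonneg fun j _ => mul_nonneg (hq0 _) (hK0 _ _)), ← Finset.mul_sum] at h
      have := hqpos i hi
      exact (mul_left_cancel₀ this.ne' (by rw [← h, mul_one]))
    · exact fun j _ => mul_nonneg (hq0 _) (hK0 _ _)
    · intro j hj
      rw [hKz i hi j (by simpa using hj)]; simp
  -- measure preserving
  have mp : MeasurePreserving (shiftN 1) μ μ := by
    refine ⟨measurable_shiftN 1, ?_⟩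
    have : IsFiniteMeasure (μ.map (shiftN 1)) := inferInstance
    refine measure_ext_cyl _ _ fun n x => ?_
    rw [Measure.map_apply (measurable_shiftN 1) (measurableSet_cyl n x),
      measure_split μ _ (measurable_shiftN 1 (measurableSet_cyl n x)) 0, hμ n x]
    have key : ∀ a, μ (shiftN 1 ⁻¹' cyl n x ∩ {ω | ω 0 = a}) =
        ENNReal.ofReal (q a * K a (x 0) * ∏ t ∈ Finset.range n, K (x t) (x (t + 1))) := by
      intro a
      have h2 : shiftN 1 ⁻¹' cyl n x ∩ {ω | ω 0 = a} =
          cyl (n + 1) (fun t => if t = 0 then a else x (t - 1)) := by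
        ext ω
        simp only [cyl, shiftN, Set.mem_preimage, Set.mem_ofPred_eq, Set.mem_inter_iff]
        constructor
        · rintro ⟨h, h'⟩ t ht
          rcases t with _ | t
          · simpa using h'
          · have := h t (by omega)
            rw [add_comm] at this
            simpa using this
        · intro h
          refine ⟨fun t ht => ?_, by simpa using h 0 (by simp)⟩
          have := h (1 + t) (by omega)
          simpa using this
      rw [h2, hμ, Finset.prod_range_succ']
      congr 1
      simp
      ring
    simp only [key]
    rw [tsum_eq_sum (s := Finset.range (N + 1)), ← ENNReal.ofReal_sum_of_nonneg]
    · congr 1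
      rw [← Finset.sum_mul]
      congr 1
      by_cases hx : x 0 ≤ N
      · rw [Finset.sum_congr rfl fun a ha =>
          rev a (by simpa [Nat.lt_succ_iff] using ha) (x 0) hx, ← Finset.mul_sum, row _ hx, mul_one]
      · rw [hqz _ (not_le.1 hx)]
        refine Finset.sum_eq_zero fun a ha => ?_
        rw [hKz a (by simpa [Nat.lt_succ_iff] using ha) _ (not_le.1 hx), mul_zero]
    · exact fun j _ => mul_nonneg (mul_nonneg (hq0 _) (hK0 _ _)) (hP0 _ _)
    · intro j hj
      rw [hqz j (by simpa using hj)]; simp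
  -- Markov property
  have markov : ∀ n (x : ℕ → ℕ) (B : Set (ℕ → ℕ)), MeasurableSet B →
      ENNReal.ofReal (q (x n)) * μ (shiftN n ⁻¹' B ∩ cyl n x) =
        μ (cyl n x) * μ (B ∩ {ω | ω 0 = x n}) := by
    intro n x B hB
    have : ENNReal.ofReal (q (x n)) • (μ.restrict (cyl n x)).map (shiftN n) =
        μ (cyl n x) • μ.restrict {ω | ω 0 = x n} := by
      have : IsFiniteMeasure
          (ENNReal.ofReal (q (x n)) • (μ.restrict (cyl n x)).map (shiftN n)) :=
        Measure.smul_finite _ ENNReal.ofReal_ne_top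
      refine measure_ext_cyl _ _ fun m y => ?_
      simp only [Measure.smul_apply, smul_eq_mul]
      rw [Measure.map_apply (measurable_shiftN n) (measurableSet_cyl m y),
        Measure.restrict_apply (measurable_shiftN n (measurableSet_cyl m y)),
        Measure.restrict_apply (measurableSet_cyl m y)]
      by_cases hxy : y 0 = x n
      · have h1 : cyl m y ∩ {ω | ω 0 = x n} = cyl m y := by
          refine Set.inter_eq_left.2 fun ω h => ?_
          exact (h 0 (by simp)).trans hxy
        set z : ℕ → ℕ := fun t => if t ≤ n then x t else y (t - n) with hz
        have hz1 : ∀ t ≤ n, z t = x t := fun t ht => by simp [hz, ht]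
        have hz2 : ∀ t, z (n + t) = y t := fun t => by
          rcases t with _ | t
          · simp [hz, hxy]
          · simp [hz]
        have h2 : shiftN n ⁻¹' cyl m y ∩ cyl n x = cyl (n + m) z := by
          ext ω
          simp only [cyl, shiftN, Set.mem_preimage, Set.mem_ofPred_eq, Set.mem_inter_iff]
          constructor
          · rintro ⟨h, h'⟩ t ht
            by_cases htn : t ≤ n
            · rw [hz1 t htn, h' t htn]
            · obtain ⟨s, rfl⟩ := Nat.exists_eq_add_of_le (not_le.1 htn).le
              rw [hz2, h s (by omega)]
          · intro h
            refine ⟨fun t ht => ?_, fun t ht => ?_⟩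
            · rw [h _ (by omega), hz2]
            · rw [h _ (by omega), hz1 _ ht]
        rw [h1, h2, hμ, hμ, hμ, ← ENNReal.ofReal_mul (hq0 _),
          ← ENNReal.ofReal_mul (mul_nonneg (hq0 _) (hP0 _ _)), Finset.prod_range_add]
        congr 1
        rw [Finset.prod_congr rfl (g := fun t => K (x t) (x (t + 1))) fun t ht => by
            have := Finset.mem_range.1 ht
            rw [hz1 t this.le, hz1 (t + 1) this],
          Finset.prod_congr (s₁ := Finset.range m) rfl (g := fun t => K (y t) (y (t + 1)))
            fun t _ => by rw [add_assoc, hz2, hz2], hz1 0 (by simp), hxy]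
        ring
      · have h1 : cyl m y ∩ {ω | ω 0 = x n} = ∅ := by
          refine Set.eq_empty_of_forall_notMem ?_
          rintro ω ⟨h, h'⟩
          exact hxy ((h 0 (by simp)).symm.trans h')
        have h2 : shiftN n ⁻¹' cyl m y ∩ cyl n x = ∅ := by
          refine Set.eq_empty_of_forall_notMem ?_
          rintro ω ⟨h, h'⟩
          have h3 := h 0 (by simp)
          have h4 := h' n le_rfl
          simp only [shiftN, add_zero] at h3
          exact hxy (h3.symm.trans h4)
        rw [h1, h2]; simp
    have h := congrArg (fun ν : Measure (ℕ → ℕ) => ν B) this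
    simp only [Measure.smul_apply, smul_eq_mul] at h
    rwa [Measure.map_apply (measurable_shiftN n) hB,
        Measure.restrict_apply (measurable_shiftN n hB),
        Measure.restrict_apply hB] at h
  refine ⟨mp, ⟨fun A hA hinv => ?_⟩⟩
  have hinvn : ∀ n, shiftN n ⁻¹' A = A := by
    intro n
    induction n with
    | zero =>
      have : shiftN 0 = id := by funext ω t; simp [shiftN]
      rw [this, Set.preimage_id]
    | succ n ih =>
      have : shiftN (n + 1) = shiftN n ∘ shiftN 1 := by
        funext ω t; simp only [shiftN, Function.comp]; congr 1; ring
      rw [this, Set.preimage_comp, ih, hinv]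
  have hcyl0 : ∀ n (x : ℕ → ℕ), N < x n → μ (cyl n x) = 0 := by
    intro n x hx
    have mpn : ∀ n, MeasurePreserving (shiftN n) μ μ := by
      intro n
      induction n with
      | zero =>
        have : shiftN 0 = id := by funext ω t; simp [shiftN]
        rw [this]; exact MeasurePreserving.id μ
      | succ n ih =>
        have : shiftN (n + 1) = shiftN n ∘ shiftN 1 := by
          funext ω t; simp only [shiftN, Function.comp]; congr 1; ring
        rw [this]; exact ih.comp mp
    have h := (mpn n).measure_preimage (measurableSet_coord 0 (x n)).nullMeasurableSet
    rw [hμ0, hqz _ hx, ENNReal.ofReal_zero] at h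
    refine measure_mono_null (fun ω hω => ?_) h
    simpa [shiftN] using hω n le_rfl
  -- harmonic function
  set g : ℕ → ℝ := fun i => μ.real (A ∩ {ω | ω 0 = i}) with hg
  have hmark : ∀ n (x : ℕ → ℕ), q (x n) * μ.real (A ∩ cyl n x) = μ.real (cyl n x) * g (x n) := by
    intro n x
    have := congrArg ENNReal.toReal (markov n x A hA)
    rw [ENNReal.toReal_mul, ENNReal.toReal_mul, hinvn, ENNReal.toReal_ofReal (hq0 _)] at this
    exact this
  set h : ℕ → ℝ := fun i => g i / q i with hh
  have hmark' : ∀ n (x : ℕ → ℕ), x n ≤ N → μ.real (A ∩ cyl n x) = μ.real (cyl n x) * h (x n) := by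
    intro n x hx
    have := hqpos _ hx
    have h2 := hmark n x
    simp only [hh]
    field_simp
    linarith
  have harm : ∀ i ≤ N, h i = ∑ j ∈ Finset.range (N + 1), K i j * h j := by
    intro i hi
    have e := measure_split μ _ (hA.inter (measurableSet_coord 0 i)) 1
    have hc : ∀ j, {ω : ℕ → ℕ | ω 0 = i} ∩ {ω | ω 1 = j} = cyl 1 (fun t => if t = 0 then i else j) := by
      intro j
      ext ω
      simp only [cyl, Set.mem_ofPred_eq, Set.mem_inter_iff]
      constructor
      · rintro ⟨h, h'⟩ t ht
        interval_cases t <;> simp [h, h']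
      · intro h; exact ⟨by simpa using h 0 (by simp), by simpa using h 1 le_rfl⟩
    simp only [Set.inter_assoc] at e
    rw [tsum_eq_sum (s := Finset.range (N + 1))] at e
    · have e2 := congrArg ENNReal.toReal e
      rw [ENNReal.toReal_sum fun _ _ => measure_ne_top _ _] at e2
      have e3 : g i = ∑ j ∈ Finset.range (N + 1), q i * (K i j * h j) := by
        refine e2.trans (Finset.sum_congr rfl fun j hj => ?_)
        have hj' : j ≤ N := by simpa [Nat.lt_succ_iff] using hj
        have := hmark' 1 (fun t => if t = 0 then i else j) (by simpa using hj')
        rw [← hc, measureReal_def, measureReal_def, hμ1,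
          ENNReal.toReal_ofReal (mul_nonneg (hq0 _) (hK0 _ _))] at this
        rw [this]
        simp
        ring
      rw [← Finset.mul_sum] at e3
      have := hqpos i hi
      simp only [hh]
      rw [div_eq_iff this.ne', e3, mul_comm]
    · intro j hj
      refine measure_mono_null Set.inter_subset_right ?_
      rw [hc]
      exact hcyl0 1 _ (by simpa using hj)
  -- maximum principle
  obtain ⟨m, hm, hmax⟩ := Finset.exists_max_image (Finset.range (N + 1)) h ⟨0, by simp⟩
  have hm' : m ≤ N := by simpa [Nat.lt_succ_iff] using hm
  have hconst : ∀ j ≤ N, h j = h m := by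
    have hz : ∑ j ∈ Finset.range (N + 1), K m j * (h m - h j) = 0 := by
      simp only [mul_sub, Finset.sum_sub_distrib]
      rw [← harm m hm', ← Finset.sum_mul, row m hm']; ring
    rw [Finset.sum_eq_zero_iff_of_nonneg
      fun j hj => mul_nonneg (hK0 _ _) (sub_nonneg.2 (hmax j hj))] at hz
    intro j hj
    have h1 := hz j (by simpa [Nat.lt_succ_iff] using hj)
    have h2 := hKpos m hm' j hj
    rcases mul_eq_zero.1 h1 with h3 | h3
    · exact absurd h3 h2.ne'
    · linarith
  have hhm : 0 ≤ h m := div_nonneg measureReal_nonneg (hq0 _)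
  have hfin : μ.restrict A = ENNReal.ofReal (h m) • μ := by
    refine measure_ext_cyl _ _ fun n x => ?_
    rw [Measure.restrict_apply (measurableSet_cyl n x), Set.inter_comm, Measure.smul_apply,
      smul_eq_mul]
    by_cases hx : x n ≤ N
    · have h1 := hmark' n x hx
      rw [hconst _ hx] at h1
      rw [← ofReal_measureReal (μ := μ) (s := A ∩ cyl n x), h1,
        ENNReal.ofReal_mul measureReal_nonneg, ofReal_measureReal, mul_comm]
    · rw [measure_mono_null Set.inter_subset_right (hcyl0 n x (not_le.1 hx)),
        hcyl0 n x (not_le.1 hx), mul_zero]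
  have e1 := congrArg (fun ν : Measure (ℕ → ℕ) => ν Set.univ) hfin
  have e2 := congrArg (fun ν : Measure (ℕ → ℕ) => ν Aᶜ) hfin
  simp at e1
  simp [Measure.restrict_apply hA.compl] at e2
  rw [eventuallyConst_set']
  rcases e2 with h0 | h0
  · left
    rw [ae_eq_empty, e1, ENNReal.ofReal_eq_zero.2 h0]
  · right
    exact ae_eq_univ.2 h0

section bar
variable (N : ℕ) (p ρ : ℝ)

lemma barK_factor (hp0 : 0 < p) (hp1 : p < 1)
    (hρl : max (-(p / (1 - p))) (-((1 - p) / p)) < ρ) (hρu : ρ < 1) :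
    0 < p * (1 - ρ) + ρ ∧ 0 < 1 - (p * (1 - ρ) + ρ) ∧ 0 < p * (1 - ρ) ∧
      0 < 1 - p * (1 - ρ) := by
  obtain ⟨h1, h2⟩ := max_lt_iff.1 hρl
  have hq : 0 < 1 - p := by linarith
  rw [neg_lt, lt_div_iff₀ hq] at h1
  rw [neg_lt, lt_div_iff₀ hp0] at h2
  refine ⟨by nlinarith, ?_, mul_pos hp0 (by linarith), by nlinarith⟩
  have : 1 - (p * (1 - ρ) + ρ) = (1 - ρ) * (1 - p) := by ring
  rw [this]; exact mul_pos (by linarith) hq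

lemma choose_symm3 {N i j k : ℕ} (hi : i ≤ N) (hj : j ≤ N) (hk1 : i + j - N ≤ k)
    (hki : k ≤ i) (hkj : k ≤ j) :
    N.choose i * (i.choose k * (N - i).choose (j - k)) =
      N.choose j * (j.choose k * (N - j).choose (i - k)) := by
  have key : ∀ i j : ℕ, i ≤ N → j ≤ N → i + j - N ≤ k → k ≤ i → k ≤ j →
      N.choose i * (i.choose k * (N - i).choose (j - k)) *
        (k.factorial * (i - k).factorial * (j - k).factorial * (N + k - (i + j)).factorial)
        = N.factorial := by
    intro i j hi hj hk1 hki hkj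
    have a := Nat.choose_mul_factorial_mul_factorial hi
    have b := Nat.choose_mul_factorial_mul_factorial hki
    have c := Nat.choose_mul_factorial_mul_factorial (show j - k ≤ N - i by omega)
    rw [show N - i - (j - k) = N + k - (i + j) by omega] at c
    rw [← a, ← b, ← c]; ring
  have h1 := key i j hi hj hk1 hki hkj
  have h2 := key j i hj hi (by omega) hkj hki
  rw [add_comm j i] at h2
  have hpos : 0 < k.factorial * (i - k).factorial * (j - k).factorial *
    (N + k - (i + j)).factorial := by positivity
  apply Nat.eq_of_mul_eq_mul_right hpos
  rw [h1, ← h2]; ring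

lemma bar_rev {i j : ℕ} (hi : i ≤ N) (hj : j ≤ N) :
    binomPMF N p i * barK N ρ p i j = binomPMF N p j * barK N ρ p j i := by
  unfold binomPMF barK
  rw [Finset.mul_sum, Finset.mul_sum, add_comm j i, min_comm j i]
  refine Finset.sum_congr rfl fun k hk => ?_
  rw [Finset.mem_Icc, le_min_iff] at hk
  obtain ⟨hk1, hki, hkj⟩ := hk
  have hc : (N.choose i : ℝ) * (i.choose k * (N - i).choose (j - k)) =
      N.choose j * (j.choose k * (N - j).choose (i - k)) := by
    exact_mod_cast choose_symm3 hi hj hk1 hki hkj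
  obtain ⟨a, rfl⟩ := Nat.exists_eq_add_of_le hki
  obtain ⟨b, rfl⟩ := Nat.exists_eq_add_of_le hkj
  obtain ⟨c, hcN⟩ : ∃ c, N = k + a + b + c := ⟨N - (k + a + b), by omega⟩
  simp only [show k + a - k = a by omega, show k + b - k = b by omega,
    show N + k - (k + a + (k + b)) = c by omega] at hc ⊢
  rw [show N - (k + a) = b + c by omega, show N - (k + b) = a + c by omega] at hc ⊢
  have e : 1 - (p * (1 - ρ) + ρ) = (1 - ρ) * (1 - p) := by ring
  rw [e]
  simp only [mul_pow, pow_add]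
  linear_combination (p ^ k * p ^ a * (1 - p) ^ b * (1 - p) ^ c * (p * (1 - ρ) + ρ) ^ k *
    (1 - ρ) ^ a * (1 - p) ^ a * p ^ b * (1 - ρ) ^ b * (1 - p * (1 - ρ)) ^ c) * hc

end bar

/-- **Ergodicity of the BAR(1) process.**
The shift map `T(ω)_t = ω_{t+1}` is ergodic with respect to the trajectory law `μ` of
the BAR(1) chain started from Binomial(N,p): it preserves `μ` and every measurable
shift-invariant set is null or conull. -/
theorem bar_ergodic
    (N : ℕ) (hN : 1 ≤ N) (p ρ : ℝ) (hp0 : 0 < p) (hp1 : p < 1)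
    (hρl : max (-(p / (1 - p))) (-((1 - p) / p)) < ρ) (hρu : ρ < 1)
    (μ : Measure (ℕ → ℕ)) [IsProbabilityMeasure μ]
    (hμ : ∀ (n : ℕ) (x : ℕ → ℕ),
      μ {ω | ∀ t ≤ n, ω t = x t} =
        ENNReal.ofReal (binomPMF N p (x 0) *
          ∏ t ∈ Finset.Icc 1 n, barK N ρ p (x (t - 1)) (x t))) :
    Ergodic (fun ω : ℕ → ℕ => fun t => ω (t + 1)) μ := by
  obtain ⟨f1, f2, f3, f4⟩ := barK_factor p ρ hp0 hp1 hρl hρu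
  have hq : 0 < 1 - p := by linarith
  have hT : (fun ω : ℕ → ℕ => fun t => ω (t + 1)) = shiftN 1 := by
    funext ω t; simp [shiftN, add_comm]
  rw [hT]
  refine ergodic_of_chain N (binomPMF N p) (barK N ρ p) ?_ ?_ ?_ ?_ ?_ ?_ ?_ μ ?_
  · intro i; unfold binomPMF; positivity
  · intro i hi
    have := Nat.choose_pos hi
    unfold binomPMF; positivity
  · intro i hi; simp [binomPMF, Nat.choose_eq_zero_of_lt hi]
  · intro i j
    unfold barK
    exact Finset.sum_nonneg fun k _ => by positivity
  · intro i hi j hj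
    unfold barK
    refine Finset.sum_pos (fun k hk => ?_) ⟨i + j - N, Finset.mem_Icc.2 ⟨le_rfl, by omega⟩⟩
    rw [Finset.mem_Icc, le_min_iff] at hk
    have h1 := Nat.choose_pos hk.2.1
    have h2 : 0 < (N - i).choose (j - k) := Nat.choose_pos (by omega)
    positivity
  · intro i hi j hj
    unfold barK
    rw [Finset.Icc_eq_empty (by omega), Finset.sum_empty]
  · exact fun i hi j hj => bar_rev N p ρ hi hj
  · intro n x
    refine (hμ n x).trans ?_
    congr 2
    clear hμ
    induction n with
    | zero => simp
    | succ n ih => rw [Finset.prod_Icc_succ_top (by omega), Finset.prod_range_succ, ih]; simp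
end
end

section
/- (Geometric ergodicity of the BAR(1) chain.) There exists a constant C ≥ 0 such that for every integer h ≥ 1 and all i, j ∈ S, | K^h(i,{j}) − C(N,j) p^j (1−p)^{N−j} | ≤ C |ρ|^h, where K^h denotes the h-fold composition of the BAR(1) kernel. In particular, the h-step transition probabilities converge to the Binomial(N, p) probabilities at a geometric rate. -/
open MeasureTheory Filter Finset Matrix

noncomputable section

lemma bar_gen (N : ℕ) (ρ p : ℝ) (i : ℕ) (hi : i ≤ N) (A B : ℝ) :
    ∑ j ∈ Finset.range (N + 1), barK N ρ p i j * (A ^ j * B ^ (N - j)) =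
      ((p * (1 - ρ) + ρ) * A + (1 - (p * (1 - ρ) + ρ)) * B) ^ i *
        ((p * (1 - ρ)) * A + (1 - p * (1 - ρ)) * B) ^ (N - i) := by
  rw [add_pow, add_pow, Finset.sum_mul_sum]
  unfold barK
  simp_rw [Finset.sum_mul]
  rw [Finset.sum_sigma', Finset.sum_sigma']
  refine Finset.sum_bij' (fun x _ => ⟨x.2, x.1 - x.2⟩) (fun y _ => ⟨y.1 + y.2, y.1⟩) ?_ ?_ ?_ ?_ ?_
  · rintro ⟨j, k⟩ h
    simp only [Finset.mem_sigma, Finset.mem_range, Finset.mem_Icc, le_min_iff] at h ⊢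
    omega
  · rintro ⟨j, k⟩ h
    simp only [Finset.mem_sigma, Finset.mem_range, Finset.mem_Icc, le_min_iff] at h ⊢
    omega
  · rintro ⟨j, k⟩ h
    simp only [Finset.mem_sigma, Finset.mem_range, Finset.mem_Icc, le_min_iff] at h
    have : k + (j - k) = j := by omega
    simp [this]
  · rintro ⟨j, k⟩ h
    simp
  · rintro ⟨j, k⟩ h
    simp only [Finset.mem_sigma, Finset.mem_range, Finset.mem_Icc, le_min_iff] at h ⊢
    obtain ⟨l, rfl⟩ : ∃ l, j = k + l := ⟨j - k, by omega⟩
    obtain ⟨m, rfl⟩ : ∃ m, i = k + m := ⟨i - k, by omega⟩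
    obtain ⟨n, rfl⟩ : ∃ n, N = k + m + l + n := ⟨N - (k + m + l), by omega⟩
    have e1 : k + l - k = l := by omega
    have e2 : k + m - k = m := by omega
    have e3 : k + m + l + n - (k + m) = l + n := by omega
    have e4 : l + n - l = n := by omega
    have e5 : k + m + l + n + k - (k + m + (k + l)) = n := by omega
    have e6 : k + m + l + n - (k + l) = m + n := by omega
    simp only [e1, e2, e3, e4, e5, e6, mul_pow, pow_add]
    ring

lemma coeff_unique (n : ℕ) (c d : ℕ → ℝ)
    (h : ∀ x : ℝ, ∑ j ∈ Finset.range n, c j * x ^ j = ∑ j ∈ Finset.range n, d j * x ^ j)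
    (k : ℕ) (hk : k < n) : c k = d k := by
  have : (∑ j ∈ Finset.range n, Polynomial.C (c j) * Polynomial.X ^ j) =
      ∑ j ∈ Finset.range n, Polynomial.C (d j) * Polynomial.X ^ j := by
    apply Polynomial.funext
    intro x
    simpa [Polynomial.eval_finsetSum] using h x
  have := congrArg (fun q => Polynomial.coeff q k) this
  simpa [Polynomial.finsetSum_coeff, Polynomial.coeff_X_pow, hk] using this

lemma bar_mul (N : ℕ) (ρ ρ' p : ℝ) :
    barMat N ρ p * barMat N ρ' p = barMat N (ρ * ρ') p := by
  ext i k
  have hi : (i : ℕ) ≤ N := by omega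
  rw [Matrix.mul_apply]
  simp only [barMat, Matrix.of_apply]
  rw [Fin.sum_univ_eq_sum_range (fun j => barK N ρ p i j * barK N ρ' p j k) (N + 1)]
  refine coeff_unique (N + 1)
    (fun k => ∑ j ∈ Finset.range (N + 1), barK N ρ p i j * barK N ρ' p j k)
    (fun k => barK N (ρ * ρ') p i k) ?_ k k.2
  intro x
  have h1 := bar_gen N (ρ * ρ') p i hi x 1
  simp only [one_pow, mul_one] at h1
  rw [h1]
  simp_rw [Finset.sum_mul]
  rw [Finset.sum_comm]
  have h2 := bar_gen N ρ p i hi ((p * (1 - ρ') + ρ') * x + (1 - (p * (1 - ρ') + ρ')))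
    ((p * (1 - ρ')) * x + (1 - p * (1 - ρ')))
  refine Eq.trans (b := ∑ j ∈ Finset.range (N + 1), barK N ρ p i j *
    (((p * (1 - ρ') + ρ') * x + (1 - (p * (1 - ρ') + ρ'))) ^ j *
      ((p * (1 - ρ')) * x + (1 - p * (1 - ρ'))) ^ (N - j))) ?_ ?_
  · refine Finset.sum_congr rfl fun j hj => ?_
    have h3 := bar_gen N ρ' p j (by simp at hj; omega) x 1
    simp only [one_pow, mul_one] at h3
    rw [← h3, Finset.mul_sum]
    exact Finset.sum_congr rfl fun l _ => mul_assoc _ _ _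
  · rw [h2]
    congr 2 <;> ring

lemma bar_zero (N : ℕ) (p : ℝ) (i j : ℕ) (hi : i ≤ N) (hj : j ≤ N) :
    barK N 0 p i j = binomPMF N p j := by
  refine coeff_unique (N + 1) (fun j => barK N 0 p i j) (fun j => binomPMF N p j) ?_ j (by omega)
  intro x
  have h1 := bar_gen N 0 p i hi x 1
  simp only [one_pow, mul_one, sub_zero, add_zero, ← pow_add] at h1
  rw [h1, Nat.add_sub_cancel' hi, add_pow]
  refine Finset.sum_congr rfl fun j _ => ?_
  unfold binomPMF
  rw [mul_pow]
  ring

lemma bar_pow (N : ℕ) (ρ p : ℝ) (h : ℕ) (hh : 1 ≤ h) :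
    barMat N ρ p ^ h = barMat N (ρ ^ h) p := by
  induction h, hh using Nat.le_induction with
  | base => simp
  | succ n _ ih => rw [pow_succ, ih, bar_mul, pow_succ]

lemma bar_lip (N : ℕ) (p : ℝ) (i j : ℕ) (hi : i ≤ N) (hj : j ≤ N) :
    ∃ C : ℝ, ∀ r ∈ Set.Icc (-1 : ℝ) 1, |barK N r p i j - binomPMF N p j| ≤ C * |r| := by
  have hd : Differentiable ℝ (fun r => barK N r p i j) := by
    unfold barK
    fun_prop
  have hc : ContinuousOn (dslope (fun r => barK N r p i j) 0) Set.univ :=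
    (continuousOn_dslope Filter.univ_mem).2 ⟨hd.continuous.continuousOn, hd 0⟩
  obtain ⟨C, hC⟩ := (isCompact_Icc (a := (-1 : ℝ)) (b := 1)).exists_bound_of_continuousOn
    (hc.mono (Set.subset_univ _))
  refine ⟨C, fun r hr => ?_⟩
  have h1 := sub_smul_dslope (fun r => barK N r p i j) 0 r
  simp only [bar_zero N p i j hi hj] at h1
  rw [← h1, sub_zero, smul_eq_mul, abs_mul, mul_comm]
  exact mul_le_mul_of_nonneg_right (hC r hr) (abs_nonneg r)

/-- **Geometric ergodicity of the BAR(1) chain.**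
There is a constant `C ≥ 0` such that for all `h ≥ 1` and `i, j ∈ S`,
`|K^h(i,{j}) - C(N,j) p^j (1-p)^{N-j}| ≤ C |ρ|^h`. -/
theorem bar_geometric_ergodicity
    (N : ℕ) (hN : 1 ≤ N) (p ρ : ℝ) (hp0 : 0 < p) (hp1 : p < 1)
    (hρl : max (-(p / (1 - p))) (-((1 - p) / p)) < ρ) (hρu : ρ < 1) :
    ∃ C : ℝ, 0 ≤ C ∧ ∀ h : ℕ, 1 ≤ h → ∀ i j : Fin (N + 1),
      |(barMat N ρ p ^ h) i j - binomPMF N p (j : ℕ)| ≤ C * |ρ| ^ h := by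
  have hρ1 : |ρ| ≤ 1 := by
    rw [abs_le]
    refine ⟨?_, hρu.le⟩
    rw [max_lt_iff] at hρl
    obtain ⟨h1, h2⟩ := hρl
    have hq : 0 < 1 - p := by linarith
    rcases le_total p (1 - p) with h | h
    · have : p / (1 - p) ≤ 1 := (div_le_one hq).2 h
      linarith
    · have : (1 - p) / p ≤ 1 := (div_le_one hp0).2 h
      linarith
  have key : ∀ i j : Fin (N + 1), ∃ C : ℝ, ∀ r ∈ Set.Icc (-1 : ℝ) 1,
      |barK N r p i j - binomPMF N p j| ≤ C * |r| :=
    fun i j => bar_lip N p i j (by omega) (by omega)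
  choose C hC using key
  refine ⟨∑ i, ∑ j, |C i j|, by positivity, fun h hh i j => ?_⟩
  rw [bar_pow N ρ p h hh, ← abs_pow]
  have hr : ρ ^ h ∈ Set.Icc (-1 : ℝ) 1 := by
    rw [Set.mem_Icc, ← abs_le, abs_pow]
    exact pow_le_one₀ (abs_nonneg _) hρ1
  refine (hC i j _ hr).trans (mul_le_mul_of_nonneg_right ?_ (abs_nonneg _))
  calc C i j ≤ |C i j| := le_abs_self _
    _ ≤ ∑ j, |C i j| :=
      Finset.single_le_sum (f := fun j => |C i j|) (fun _ _ => abs_nonneg _) (Finset.mem_univ j)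
    _ ≤ ∑ i, ∑ j, |C i j| :=
      Finset.single_le_sum (f := fun i => ∑ j, |C i j|)
        (fun _ _ => Finset.sum_nonneg fun _ _ => abs_nonneg _) (Finset.mem_univ i)
end
end
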